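/- arXiv:math/0601397 — 2 statements merged into one kernel-verified Lean document; each statement's English description precedes it below -/
import Mathlib

section
/- The polynomial f(x) = x^11 + 5x^7 − 4x^6 − 20x^5 + 4x^4 + 20x^3 + 1 is irreducible over ℚ, has exactly 10 non-real complex roots, and its Galois group over ℚ is isomorphic to the symmetric group S_11. -/
open Polynomial

/-- The integral form of the polynomial under study. -/
noncomputable def hendecic : ℤ[X] :=
  X ^ 11 + 5 * X ^ 7 - 4 * X ^ 6 - 20 * X ^ 5 + 4 * X ^ 4 + 20 * X ^ 3 + 1

/-- The cofactor of `X ^ 2 + X + 1` in the reduction of `hendecic` modulo `2`. -/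
noncomputable def nonic : (ZMod 2)[X] :=
  X ^ 9 + X ^ 8 + X ^ 6 + X ^ 4 + X ^ 3 + X + 1

theorem monic_hendecic : hendecic.Monic := by
  unfold hendecic; monicity!

theorem natDegree_hendecic : hendecic.natDegree = 11 := by
  unfold hendecic; compute_degree!

theorem monic_nonic : nonic.Monic := by
  unfold nonic; monicity!

theorem natDegree_nonic : nonic.natDegree = 9 := by
  unfold nonic; compute_degree!

section CharTwo

variable {R : Type*} [CommRing R]

theorem pow_512_eq_of_quadratic_eq_zero (h2 : (2 : R) = 0) {x : R} (hx : x ^ 2 + x + 1 = 0) :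
    x ^ 512 = x + 1 := by
  have h3 : x ^ 3 = 1 := by linear_combination (x - 1) * hx
  have : x ^ 512 = x ^ 2 := by
    rw [show 512 = 3 * 170 + 2 by norm_num, pow_add, pow_mul, h3, one_pow, one_mul]
  linear_combination this + hx - (x + 1) * h2

theorem pow_512_eq_of_nonic_eq_zero (h2 : (2 : R) = 0) {x : R}
    (hx : x ^ 9 + x ^ 8 + x ^ 6 + x ^ 4 + x ^ 3 + x + 1 = 0) : x ^ 512 = x := by
  have h4 : x ^ 16 = x ^ 8 + x ^ 5 + x := by
    linear_combination (x ^ 7 + x ^ 6 + x ^ 5 + x ^ 3 + x ^ 2 + x) * hx +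
      (-x ^ 15 - x ^ 14 - x ^ 13 - x ^ 12 - 2 * x ^ 11 - 2 * x ^ 10 - 2 * x ^ 9 - 2 * x ^ 8 -
        2 * x ^ 7 - 2 * x ^ 6 - 2 * x ^ 5 - x ^ 4 - x ^ 3 - x ^ 2 - x) * h2
  have h5 : x ^ 32 = x ^ 7 + x ^ 6 + x ^ 3 + x + 1 := by
    linear_combination (x ^ 16 + x ^ 8 + x ^ 5 + x) * h4 + (x ^ 7 + x ^ 6 + x ^ 5 + x ^ 3 +
        x ^ 2 + 1) * hx +
      (-x ^ 15 - x ^ 14 - x ^ 12 - 2 * x ^ 11 - x ^ 10 - x ^ 9 - 2 * x ^ 8 - 2 * x ^ 7 -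
        2 * x ^ 6 - x ^ 5 - x ^ 4 - 2 * x ^ 3 - x - 1) * h2
  have h6 : x ^ 64 = x ^ 7 + x ^ 5 + x := by
    linear_combination (x ^ 32 + x ^ 7 + x ^ 6 + x ^ 3 + x + 1) * h5 + (x ^ 5 + x ^ 4 + x ^ 2 +
        1) * hx +
      (-x ^ 11 - x ^ 8 + x ^ 7 - 2 * x ^ 5) * h2
  have h7 : x ^ 128 = x ^ 3 + x ^ 2 := by
    linear_combination (x ^ 64 + x ^ 7 + x ^ 5 + x) * h6 + (x ^ 5 + x ^ 4 + x ^ 3) * hx +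
      (-x ^ 13 - x ^ 11 - x ^ 9 - x ^ 7 - x ^ 5 - x ^ 4 - x ^ 3) * h2
  have h8 : x ^ 256 = x ^ 6 + x ^ 4 := by
    linear_combination (x ^ 128 + x ^ 3 + x ^ 2) * h7 + x ^ 5 * h2
  linear_combination (x ^ 256 + x ^ 6 + x ^ 4) * h8 + (x ^ 3 + x ^ 2 + x) * hx +
      (-x ^ 11 - x ^ 9 - x ^ 7 - x ^ 6 - x ^ 5 - x ^ 4 - x ^ 3 - x ^ 2 - x) * h2

theorem map_hendecic_of_two_eq_zero (h2 : (2 : R) = 0) (φ : ℤ →+* R) :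
    hendecic.map φ = X ^ 11 + X ^ 7 + 1 := by
  have h : (2 : R[X]) = 0 := by rw [← C_ofNat, h2, C_0]
  simp only [hendecic, Polynomial.map_add, Polynomial.map_sub, Polynomial.map_mul,
    Polynomial.map_pow, map_X, Polynomial.map_one, Polynomial.map_ofNat]
  linear_combination (2 * X ^ 7 - 2 * X ^ 6 - 10 * X ^ 5 + 2 * X ^ 4 + 10 * X ^ 3) * h

theorem trinomial_factorization_of_two_eq_zero (h2 : (2 : R) = 0) (x : R) :
    x ^ 11 + x ^ 7 + 1 =
      (x ^ 2 + x + 1) * (x ^ 9 + x ^ 8 + x ^ 6 + x ^ 4 + x ^ 3 + x + 1) := by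
  linear_combination
    (-x ^ 10 - x ^ 9 - x ^ 8 - x ^ 6 - x ^ 5 - x ^ 4 - x ^ 3 - x ^ 2 - x) * h2

end CharTwo

theorem two_eq_zero_zmod_two_polynomial : (2 : (ZMod 2)[X]) = 0 := CharTwo.two_eq_zero

theorem map_hendecic_zmod_two :
    hendecic.map (Int.castRingHom (ZMod 2)) = (X ^ 2 + X + 1) * nonic := by
  rw [map_hendecic_of_two_eq_zero CharTwo.two_eq_zero,
    trinomial_factorization_of_two_eq_zero CharTwo.two_eq_zero, nonic]

theorem nonic_dvd_X_pow_sub_X : nonic ∣ X ^ 512 - X := by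
  rw [← Ideal.Quotient.eq_zero_iff_dvd, map_sub, map_pow, sub_eq_zero]
  refine pow_512_eq_of_nonic_eq_zero ?_ ?_
  · rw [← map_ofNat (Ideal.Quotient.mk _), two_eq_zero_zmod_two_polynomial, map_zero]
  · have h : Ideal.Quotient.mk (Ideal.span {nonic})
        (X ^ 9 + X ^ 8 + X ^ 6 + X ^ 4 + X ^ 3 + X + 1) = 0 :=
      Ideal.Quotient.mk_singleton_self nonic
    simpa only [map_add, map_pow, map_one] using h

theorem isCoprime_nonic_X_pow_sub_X : IsCoprime nonic (X ^ 8 - X) :=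
  ⟨X ^ 7 + X ^ 5 + X ^ 4 + X ^ 3 + 1, X ^ 8 + X ^ 7 + X ^ 6 + X ^ 5 + X ^ 3 + 1, by
    unfold nonic
    linear_combination (X ^ 16 + X ^ 15 + X ^ 14 + 2 * X ^ 13 + X ^ 12 + 2 * X ^ 11 + X ^ 10 +
      X ^ 9 + 2 * X ^ 8 + X ^ 7 + X ^ 6 + X ^ 5 + X ^ 4 + X ^ 3) *
        two_eq_zero_zmod_two_polynomial⟩

theorem irreducible_nonic : Irreducible nonic := by
  obtain ⟨h, hirr, hdvd⟩ := exists_irreducible_of_natDegree_ne_zero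
    (f := nonic) (by simp [natDegree_nonic])
  have h9 : h.natDegree ∣ 3 ^ 2 := by
    apply hirr.natDegree_dvd_of_dvd_X_pow_card_pow_sub_X
    simpa using hdvd.trans nonic_dvd_X_pow_sub_X
  have h3 : ¬ h.natDegree ∣ 3 := fun h3 ↦ hirr.not_isUnit <|
    isCoprime_nonic_X_pow_sub_X.isUnit_of_dvd' hdvd <| by
      simpa using hirr.natDegree_dvd_iff_dvd_X_pow_card_pow_sub_X.mp h3
  obtain ⟨i, hi, hdeg⟩ := (Nat.dvd_prime_pow Nat.prime_three).mp h9
  have : h.natDegree = 9 := by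
    interval_cases i
    · simp [hdeg] at h3
    · simp [hdeg] at h3
    · simpa using hdeg
  exact (associated_of_dvd_of_natDegree_le hdvd monic_nonic.ne_zero
    (by rw [natDegree_nonic, this])).irreducible hirr

theorem irreducible_hendecic : Irreducible hendecic := by
  have hne : hendecic ≠ 1 := fun h ↦ by simpa [h] using natDegree_hendecic
  rw [monic_hendecic.irreducible_iff_lt_natDegree_lt hne]
  rintro q hq hdeg hdvd
  rw [natDegree_hendecic, Finset.mem_Ioc] at hdeg
  have hqm : (q.map (Int.castRingHom (ZMod 2))).natDegree = q.natDegree := hq.natDegree_map _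
  have hcop : IsCoprime nonic (q.map (Int.castRingHom (ZMod 2))) := by
    rw [irreducible_nonic.coprime_iff_not_dvd]
    intro h
    have := natDegree_le_of_dvd h (hq.map _).ne_zero
    rw [natDegree_nonic] at this
    omega
  have hquad : (X ^ 2 + X + 1 : (ZMod 2)[X]).Monic := by monicity!
  have hquad' : (X ^ 2 + X + 1 : (ZMod 2)[X]).natDegree = 2 := by compute_degree!
  have hqd : q.map (Int.castRingHom (ZMod 2)) ∣ X ^ 2 + X + 1 := by
    apply hcop.symm.dvd_of_dvd_mul_right
    rw [← map_hendecic_zmod_two]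
    exact Polynomial.map_dvd _ hdvd
  have hle := natDegree_le_of_dvd hqd hquad.ne_zero
  have ev (n : ℤ) : q.eval n ∣
      n ^ 11 + 5 * n ^ 7 - 4 * n ^ 6 - 20 * n ^ 5 + 4 * n ^ 4 + 20 * n ^ 3 + 1 := by
    simpa [hendecic] using eval_dvd (x := n) hdvd
  have hlead : q.coeff q.natDegree = 1 := hq
  have h0 := ev 0
  have h1 := ev 1
  have h1' := ev (-1)
  have h2 := ev 2
  have h2' := ev (-2)
  obtain hd | hd : q.natDegree = 1 ∨ q.natDegree = 2 := by omega
  all_goals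
    rw [hd] at hlead
    simp only [eval_eq_sum_range, hd, Finset.sum_range_succ, hlead] at h0 h1 h1' h2 h2'
    norm_num at h0 h1 h1' h2 h2'
    generalize q.coeff 0 = b at *
  · obtain rfl | rfl := Int.isUnit_iff.mp (isUnit_of_dvd_one h0) <;> norm_num at *
  · generalize q.coeff 1 = a at *
    have := Int.le_of_dvd (by norm_num) h1
    have := Int.le_of_dvd (by norm_num) ((neg_dvd).mpr h1)
    obtain rfl | rfl := Int.isUnit_iff.mp (isUnit_of_dvd_one h0)
    all_goals
      have : -11 ≤ a := by omega
      have : a ≤ 11 := by omega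
      interval_cases a <;> norm_num at *

theorem existsUnique_real_root :
    ∃! x : ℝ, x ^ 11 + 5 * x ^ 7 - 4 * x ^ 6 - 20 * x ^ 5 + 4 * x ^ 4 + 20 * x ^ 3 + 1 = 0 := by
  set p : ℝ → ℝ :=
    fun x ↦ x ^ 11 + 5 * x ^ 7 - 4 * x ^ 6 - 20 * x ^ 5 + 4 * x ^ 4 + 20 * x ^ 3 + 1 with hp
  have hcont : Continuous p := by fun_prop
  have hpos (x : ℝ) (hx : 0 ≤ x) : 0 < p x := by
    have h : 0 ≤ x ^ 8 + 5 * x ^ 4 - 4 * x ^ 3 - 20 * x ^ 2 + 4 * x + 20 := by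
      nlinarith [sq_nonneg (x ^ 4 - 2), sq_nonneg (x ^ 2 - 7 / 5), sq_nonneg (x - 6 / 5),
        mul_nonneg hx (sq_nonneg (x - 6 / 5)), sq_nonneg (x * (x - 6 / 5))]
    have := mul_nonneg (pow_nonneg hx 3) h
    simp only [hp]
    linarith
  have hmono : StrictMonoOn p (Set.Iic 0) := by
    refine strictMonoOn_of_deriv_pos (convex_Iic 0) hcont.continuousOn fun x hx ↦ ?_
    rw [interior_Iic, Set.mem_Iio] at hx
    have hd : deriv p x =
        x ^ 2 * (11 * x ^ 8 + 35 * x ^ 4 - 24 * x ^ 3 - 100 * x ^ 2 + 16 * x + 60) := by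
      have : HasDerivAt p _ x := (((((((hasDerivAt_id x).pow 11).add
        (((hasDerivAt_id x).pow 7).const_mul 5)).sub (((hasDerivAt_id x).pow 6).const_mul 4)).sub
        (((hasDerivAt_id x).pow 5).const_mul 20)).add (((hasDerivAt_id x).pow 4).const_mul 4)).add
        (((hasDerivAt_id x).pow 3).const_mul 20)).add_const 1
      rw [this.deriv]
      simp only [id]
      norm_num
      ring
    rw [hd]
    refine mul_pos (sq_pos_of_neg hx) ?_
    obtain ⟨y, rfl⟩ : ∃ y, x = -y := ⟨-x, by ring⟩
    have hy : 0 < y := by linarith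
    nlinarith [sq_nonneg (y ^ 4 - 5 / 8), sq_nonneg (y ^ 2 - 4 / 5), sq_nonneg (y - 8 / 9),
        mul_nonneg hy.le (sq_nonneg (y - 8 / 9)), sq_nonneg (y * (y - 8 / 9))]
  obtain ⟨x, hx, hx0⟩ := intermediate_value_Icc (show (-1 : ℝ) ≤ 0 by norm_num)
    hcont.continuousOn (show (0 : ℝ) ∈ Set.Icc (p (-1)) (p 0) by norm_num [hp])
  refine ⟨x, hx0, fun y hy ↦ ?_⟩
  have hy0 : y ≤ 0 := le_of_not_gt fun h ↦ (hpos y h.le).ne' hy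
  exact hmono.injOn hy0 hx.2 (Eq.trans hy hx0.symm)

/-- A permutation of the roots which reduces to the 512-th power map modulo `2` is a
transposition. -/
theorem isSwap_of_reduction {α k : Type*} [DecidableEq α] [CommRing k] [IsDomain k]
    (h2 : (2 : k) = 0) {r : α → k} (hr : Function.Injective r)
    (hroot : ∀ a, r a ^ 11 + r a ^ 7 + 1 = 0) (hquad : ∃ a, r a ^ 2 + r a + 1 = 0)
    {τ : Equiv.Perm α} (hτ : ∀ a, r (τ a) = r a ^ 512) : τ.IsSwap := by
  obtain ⟨a, ha⟩ := hquad
  have hτa : r (τ a) = r a + 1 := by rw [hτ, pow_512_eq_of_quadratic_eq_zero h2 ha]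
  have hne : a ≠ τ a := fun h ↦ by
    rw [← h] at hτa
    exact one_ne_zero (left_eq_add.mp hτa)
  refine ⟨a, τ a, hne, Equiv.ext fun c ↦ ?_⟩
  have hc := hroot c
  rw [trinomial_factorization_of_two_eq_zero h2, mul_eq_zero] at hc
  obtain hc | hc := hc
  · have hτc : r (τ c) = r c + 1 := by rw [hτ, pow_512_eq_of_quadratic_eq_zero h2 hc]
    have : (r c - r a) * (r c - r (τ a)) = 0 := by
      rw [hτa]
      linear_combination hc + ha - (r c * r a + r c + 1) * h2
    obtain h | h := mul_eq_zero.mp this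
    · obtain rfl := hr (sub_eq_zero.mp h)
      simp
    · obtain rfl := hr (sub_eq_zero.mp h)
      rw [Equiv.swap_apply_right]
      apply hr
      rw [hτc, hτa]
      linear_combination h2
  · have hτc : τ c = c := hr (by rw [hτ, pow_512_eq_of_nonic_eq_zero h2 hc])
    have hca : c ≠ a := by
      rintro rfl
      exact hne hτc.symm
    have hcτa : c ≠ τ a := by
      rintro rfl
      exact hca (τ.injective hτc)
    rw [hτc, Equiv.swap_apply_of_ne_of_ne hca hcτa]

section Galois

open NumberField

variable {K : Type*} [Field K]

/-- The integral roots of a monic integral polynomial which splits over a field already lie in its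
ring of integers. -/
theorem splits_ringOfIntegers_of_splits {F : ℤ[X]} (hF : F.Monic)
    (h : (F.map (algebraMap ℤ K)).Splits) : (F.map (algebraMap ℤ (𝓞 K))).Splits := by
  have hint : ∀ a ∈ (F.map (algebraMap ℤ K)).roots, ∃ b : 𝓞 K, algebraMap (𝓞 K) K b = a := by
    intro a ha
    refine ⟨⟨a, F, hF, ?_⟩, rfl⟩
    simpa [eval_map] using isRoot_of_mem_roots ha
  choose! φ hφ using hint
  have hprod : F.map (algebraMap ℤ (𝓞 K)) =
      (((F.map (algebraMap ℤ K)).roots.map φ).map fun b ↦ X - C b).prod := by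
    apply map_injective _ (RingOfIntegers.coe_injective (K := K))
    rw [map_map, ← IsScalarTower.algebraMap_eq, Polynomial.map_multiset_prod]
    conv_lhs => rw [h.eq_prod_roots_of_monic (hF.map _)]
    simp only [Multiset.map_map]
    congr 1
    refine Multiset.map_congr rfl fun a ha ↦ ?_
    simp [hφ a ha]
  rw [hprod]
  refine Splits.multisetProd fun p hp ↦ ?_
  obtain ⟨b, -, rfl⟩ := Multiset.mem_map.mp hp
  exact Splits.X_sub_C b

variable [CharZero K]

/-- The ninth power of a Frobenius element above `2` acts on the roots of `hendecic` as a
transposition. -/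
theorem exists_isSwap_toPermHom [NumberField K] [IsGalois ℚ K]
    [DecidableEq ((hendecic.map (algebraMap ℤ ℚ)).rootSet K)]
    (hsplit : ((hendecic.map (algebraMap ℤ ℚ)).map (algebraMap ℚ K)).Splits) :
    ∃ σ : Gal(K/ℚ), (MulAction.toPermHom Gal(K/ℚ)
      ((hendecic.map (algebraMap ℤ ℚ)).rootSet K) σ).IsSwap := by
  have : (Ideal.span {((2 : ℕ) : ℤ)}).IsMaximal := Int.ideal_span_isMaximal_of_prime 2
  obtain ⟨Q, hQ, hQ2⟩ := Ideal.exists_maximal_ideal_liesOver_of_isIntegral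
    (S := 𝓞 K) (Ideal.span {((2 : ℕ) : ℤ)})
  obtain ⟨σ, hσ⟩ := IsArithFrobAt.exists_of_isInvariant ℤ Gal(K/ℚ) Q
  have hS : (hendecic.map (algebraMap ℤ (𝓞 K))).Splits := by
    apply splits_ringOfIntegers_of_splits monic_hendecic
    rwa [map_map, ← IsScalarTower.algebraMap_eq] at hsplit
  have h2 : (2 : 𝓞 K ⧸ Q) = 0 := by
    rw [← map_ofNat (Ideal.Quotient.mk Q), Ideal.Quotient.eq_zero_iff_mem]
    simpa using (Ideal.mem_of_liesOver Q (Ideal.span {((2 : ℕ) : ℤ)}) 2).mp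
      (Ideal.mem_span_singleton_self _)
  have hcard : Nat.card (ℤ ⧸ Q.under ℤ) = 2 := by
    rw [← Ideal.over_def Q (Ideal.span {((2 : ℕ) : ℤ)}), Int.card_ideal_quot]
  have hfrob (x : 𝓞 K) : Ideal.Quotient.mk Q (σ • x) = Ideal.Quotient.mk Q x ^ 2 := by
    rw [← hcard]
    exact hσ.mk_apply x
  have hfrob9 (x : 𝓞 K) : Ideal.Quotient.mk Q (σ ^ 9 • x) = Ideal.Quotient.mk Q x ^ 512 := by
    have (n : ℕ) : Ideal.Quotient.mk Q (σ ^ n • x) = Ideal.Quotient.mk Q x ^ 2 ^ n := by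
      induction n with
      | zero => simp
      | succ n ih => rw [pow_succ', mul_smul, hfrob, ih, ← pow_mul, pow_succ]
    exact this 9
  have hmap : hendecic.map (algebraMap ℤ (𝓞 K ⧸ Q)) = X ^ 11 + X ^ 7 + 1 :=
    map_hendecic_of_two_eq_zero h2 _
  have hmonic := monic_hendecic.map (algebraMap ℤ (𝓞 K ⧸ Q))
  have hsep : (X ^ 11 + X ^ 7 + 1 : (𝓞 K ⧸ Q)[X]).Separable := by
    have h2' : (2 : (𝓞 K ⧸ Q)[X]) = 0 := by rw [← C_ofNat, h2, C_0]
    refine ⟨1, X, ?_⟩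
    simp only [derivative_add, derivative_X_pow, derivative_one, C_eq_natCast]
    push_cast
    linear_combination (6 * X ^ 11 + 4 * X ^ 7) * h2'
  rw [← hmap] at hsep
  let _ := Ideal.Quotient.field Q
  have hsplitQ : (hendecic.map (algebraMap ℤ (𝓞 K ⧸ Q))).Splits := by
    rw [IsScalarTower.algebraMap_eq ℤ (𝓞 K) (𝓞 K ⧸ Q), ← map_map]
    exact hS.map _
  let π : 𝓞 K →ₐ[ℤ] 𝓞 K ⧸ Q := Ideal.Quotient.mkₐ ℤ Q
  have himage : π '' hendecic.rootSet (𝓞 K) = hendecic.rootSet (𝓞 K ⧸ Q) :=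
    hS.image_rootSet_of_map_ne_zero π hmonic.ne_zero
  have hncard : (hendecic.rootSet (𝓞 K ⧸ Q)).ncard = 11 := by
    classical
    rw [rootSet_def, aroots_def, Set.ncard_coe_finset, Multiset.toFinset_card_of_nodup
      (nodup_roots hsep), ← hsplitQ.natDegree_eq_card_roots, monic_hendecic.natDegree_map,
      natDegree_hendecic]
  have hinj : Set.InjOn π (hendecic.rootSet (𝓞 K)) := by
    refine Set.injOn_of_ncard_image_eq (le_antisymm (Set.ncard_image_le (rootSet_finite _ _)) ?_)
      (rootSet_finite _ _)
    rw [himage, hncard, ← natDegree_hendecic]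
    exact ncard_rootSet_le _ _
  have hlift (a : (hendecic.map (algebraMap ℤ ℚ)).rootSet K) :
      ∃ b : 𝓞 K, b ∈ hendecic.rootSet (𝓞 K) ∧ algebraMap (𝓞 K) K b = a := by
    have ha : aeval (a : K) hendecic = 0 := by
      rw [← aeval_map_algebraMap ℚ]
      exact aeval_eq_zero_of_mem_rootSet a.2
    obtain ⟨b, hb⟩ : ∃ b : 𝓞 K, algebraMap (𝓞 K) K b = a :=
      ⟨⟨a, hendecic, monic_hendecic, by rwa [aeval_def] at ha⟩, rfl⟩
    refine ⟨b, ?_, hb⟩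
    rw [monic_hendecic.mem_rootSet]
    apply RingOfIntegers.coe_injective (K := K)
    rw [map_zero, ← aeval_algebraMap_apply, hb]
    exact ha
  choose φ hφ hφ' using hlift
  refine ⟨σ ^ 9, isSwap_of_reduction h2 (r := fun a ↦ π (φ a)) ?_ ?_ ?_ ?_⟩
  · intro a b hab
    ext
    rw [← hφ', ← hφ', hinj (hφ a) (hφ b) hab]
  · intro a
    have : π (φ a) ∈ hendecic.rootSet (𝓞 K ⧸ Q) := himage ▸ Set.mem_image_of_mem π (hφ a)
    have := aeval_eq_zero_of_mem_rootSet this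
    rw [aeval_def, ← eval_map, hmap] at this
    simpa using this
  · have hdvd : (X ^ 2 + X + 1 : (𝓞 K ⧸ Q)[X]) ∣ hendecic.map (algebraMap ℤ (𝓞 K ⧸ Q)) := by
      rw [hmap, trinomial_factorization_of_two_eq_zero]
      · exact dvd_mul_right _ _
      · rw [← C_ofNat, h2, C_0]
    have hdeg : (X ^ 2 + X + 1 : (𝓞 K ⧸ Q)[X]).degree = 2 := by compute_degree!
    obtain ⟨ω, hω⟩ := (hsplitQ.of_dvd hmonic.ne_zero hdvd).exists_eval_eq_zero (by simp [hdeg])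
    have hω' : ω ∈ hendecic.rootSet (𝓞 K ⧸ Q) := by
      rw [mem_rootSet', aeval_def, ← eval_map]
      exact ⟨hmonic.ne_zero, eval_eq_zero_of_dvd_of_eval_eq_zero hdvd hω⟩
    rw [← himage] at hω'
    obtain ⟨b, hb, rfl⟩ := hω'
    have hbK : (b : K) ∈ (hendecic.map (algebraMap ℤ ℚ)).rootSet K := by
      rw [(monic_hendecic.map _).mem_rootSet, aeval_map_algebraMap, aeval_algebraMap_apply,
        aeval_eq_zero_of_mem_rootSet hb, map_zero]
    refine ⟨⟨b, hbK⟩, ?_⟩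
    have : φ ⟨b, hbK⟩ = b := RingOfIntegers.coe_injective (hφ' _)
    simpa [this] using hω
  · intro a
    have : φ (σ ^ 9 • a) = σ ^ 9 • φ a := by
      apply RingOfIntegers.coe_injective (K := K)
      rw [hφ', rootSet.coe_smul, ← hφ']
      rfl
    change π (φ (σ ^ 9 • a)) = π (φ a) ^ 512
    rw [this]
    exact hfrob9 _

theorem toPermHom_rootSet_injective {F L : Type*} [Field F] [Field L] [Algebra F L] (f : F[X])
    [IsSplittingField F L f] :
    Function.Injective (MulAction.toPermHom Gal(L/F) (f.rootSet L)) := by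
  intro σ τ h
  have hle : (⊤ : Subalgebra F L) ≤ AlgHom.equalizer σ.toAlgHom τ.toAlgHom := by
    rw [← IsSplittingField.adjoin_rootSet L f, Algebra.adjoin_le_iff]
    exact fun x hx ↦ congrArg Subtype.val (Equiv.congr_fun h ⟨x, hx⟩)
  exact AlgEquiv.ext fun x ↦ hle (Algebra.mem_top (x := x))

/-- The Galois group of any splitting field of `hendecic` is the symmetric group. -/
theorem nonempty_gal_mulEquiv_perm [NumberField K]
    [IsSplittingField ℚ K (hendecic.map (algebraMap ℤ ℚ))]
    (hirr : Irreducible (hendecic.map (algebraMap ℤ ℚ))) :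
    Nonempty (Gal(K/ℚ) ≃* Equiv.Perm (Fin 11)) := by
  classical
  set f : ℚ[X] := hendecic.map (algebraMap ℤ ℚ) with hf
  have hsplit := IsSplittingField.splits K f
  have : IsGalois ℚ K := .of_separable_splitting_field (p := f) hirr.separable
  have hdeg : f.natDegree = 11 := by
    rw [hf, monic_hendecic.natDegree_map, natDegree_hendecic]
  have hcard : Fintype.card (f.rootSet K) = 11 := by
    rw [card_rootSet_eq_natDegree hirr.separable hsplit, hdeg]
  let φ := MulAction.toPermHom Gal(K/ℚ) (f.rootSet K)
  have hφ : Function.Injective φ := toPermHom_rootSet_injective f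
  have hdvd : 11 ∣ Nat.card Gal(K/ℚ) := by
    rw [← hdeg, Nat.card_congr (IsSplittingField.algEquiv K f).autCongr.toEquiv]
    exact Gal.prime_degree_dvd_card hirr (by rw [hdeg]; norm_num)
  obtain ⟨σ, hσ⟩ := exists_isSwap_toPermHom hsplit
  have htop : φ.range = ⊤ := by
    refine Equiv.Perm.subgroup_eq_top_of_swap_mem (τ := φ σ) ?_ ?_ ⟨σ, rfl⟩ hσ
    · rw [hcard]
      norm_num
    · rwa [hcard, Fintype.card_eq_nat_card,
        ← Nat.card_congr (MonoidHom.ofInjective hφ).toEquiv]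
  exact ⟨(MulEquiv.ofBijective φ ⟨hφ, MonoidHom.range_eq_top.mp htop⟩).trans
    (Fintype.equivFinOfCardEq hcard).permCongrHom⟩

end Galois

theorem nonempty_gal_hendecic_mulEquiv_perm
    (hirr : Irreducible (hendecic.map (algebraMap ℤ ℚ))) :
    Nonempty ((hendecic.map (algebraMap ℤ ℚ)).Gal ≃* Equiv.Perm (Fin 11)) := by
  have key (K : Type) [Field K] [inst : Algebra ℚ K]
      [IsSplittingField ℚ K (hendecic.map (algebraMap ℤ ℚ))] :
      Nonempty (Gal(K/ℚ) ≃* Equiv.Perm (Fin 11)) := by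
    have : CharZero K := charZero_of_injective_algebraMap (algebraMap ℚ K).injective
    obtain rfl : inst = DivisionRing.toRatAlgebra := Subsingleton.elim _ _
    have : NumberField K :=
      { to_finiteDimensional :=
          IsSplittingField.finiteDimensional K (hendecic.map (algebraMap ℤ ℚ)) }
    exact nonempty_gal_mulEquiv_perm hirr
  exact key (SplittingField _)

theorem ncard_nonreal_roots_hendecic (hirr : Irreducible (hendecic.map (algebraMap ℤ ℚ))) :
    {z : ℂ | aeval z (hendecic.map (algebraMap ℤ ℚ)) = 0 ∧ z.im ≠ 0}.ncard = 10 := by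
  obtain ⟨r, hr, huniq⟩ := existsUnique_real_root
  have haeval (z : ℂ) : aeval z (hendecic.map (algebraMap ℤ ℚ)) =
      z ^ 11 + 5 * z ^ 7 - 4 * z ^ 6 - 20 * z ^ 5 + 4 * z ^ 4 + 20 * z ^ 3 + 1 := by
    simp [hendecic, aeval_def]
  have hset : {z : ℂ | aeval z (hendecic.map (algebraMap ℤ ℚ)) = 0 ∧ z.im ≠ 0} =
      (hendecic.map (algebraMap ℤ ℚ)).rootSet ℂ \ {(r : ℂ)} := by
    ext z
    rw [Set.mem_ofPred_eq, Set.mem_sdiff, mem_rootSet_of_ne hirr.ne_zero, Set.mem_singleton_iff]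
    refine and_congr_right fun hz ↦ not_congr ⟨fun him ↦ ?_, fun h ↦ by simp [h]⟩
    lift z to ℝ using him
    rw [haeval] at hz
    exact congrArg _ (huniq z (by exact_mod_cast hz))
  have hmem : (r : ℂ) ∈ (hendecic.map (algebraMap ℤ ℚ)).rootSet ℂ := by
    rw [mem_rootSet_of_ne hirr.ne_zero, haeval]
    exact_mod_cast hr
  rw [hset, Set.ncard_sdiff_singleton_of_mem hmem, ← Nat.card_coe_set_eq, Nat.card_eq_fintype_card,
    card_rootSet_eq_natDegree hirr.separable (IsAlgClosed.splits _),
    monic_hendecic.natDegree_map, natDegree_hendecic]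

/-- The polynomial `x^11 + 5x^7 - 4x^6 - 20x^5 + 4x^4 + 20x^3 + 1` is irreducible over ℚ,
has exactly 10 non-real complex roots, and has Galois group `S₁₁`. -/
theorem example_degree_11_galois_group_symmetric
    (f : ℚ[X])
    (hf : f = X ^ 11 + 5 * X ^ 7 - 4 * X ^ 6 - 20 * X ^ 5 + 4 * X ^ 4 + 20 * X ^ 3 + 1) :
    Irreducible f ∧ {z : ℂ | aeval z f = 0 ∧ z.im ≠ 0}.ncard = 10 ∧
      Nonempty (f.Gal ≃* Equiv.Perm (Fin 11)) := by
  obtain rfl : f = hendecic.map (algebraMap ℤ ℚ) := by simp [hf, hendecic]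
  have hirr := (monic_hendecic.irreducible_iff_irreducible_map_fraction_map (K := ℚ)).mp
    irreducible_hendecic
  exact ⟨hirr, ncard_nonreal_roots_hendecic hirr, nonempty_gal_hendecic_mulEquiv_perm hirr⟩
end

section
/- Let m be an integer not divisible by 23, and let f(x) = (22m² + 506)x^23 − (23m² + 529)x^22 + 23 ∈ ℚ[x]. Then the Galois group of f over ℚ is isomorphic to the alternating group A_23. -/
open Polynomial

section
open Equiv Equiv.Perm

theorem isMultiplyPretransitive_of_isCycle_mem {α : Type*} [Fintype α] [DecidableEq α]
    {G : Subgroup (Perm α)}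
    (hG : MulAction.IsPreprimitive G α) {p : ℕ} (hp : p.Prime) (hp' : p + 3 ≤ Nat.card α)
    {g : Perm α} (hgc : g.IsCycle) (hgp : g.support.card = p) (hg : g ∈ G) :
    MulAction.IsMultiplyPretransitive G α (Nat.card α - p) := by
  obtain ⟨n, hn⟩ : ∃ n, Nat.card α = p + (n + 1) := ⟨Nat.card α - p - 1, by omega⟩
  have h : MulAction.IsMultiplyPreprimitive G α (n + 2) := by
    apply hG.isMultiplyPreprimitive (s := (g.supportᶜ : Set α))
    · apply Nat.add_left_cancel
      rw [Set.ncard_add_ncard_compl, Set.ncard_coe_finset, hgp, hn]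
    · have := hp.two_le; omega
    have := isPretransitive_of_isCycle_mem hgc hg
    apply MulAction.IsPreprimitive.of_prime_card
    convert! hp
    rw [← hgp, ← Set.ncard_coe_finset, ← Nat.card_coe_set_eq]
    refine Nat.card_congr (Equiv.subtypeEquivRight fun x => ?_)
    simp [SubMulAction.mem_ofFixingSubgroup_iff]
  have h2 := h.isMultiplyPretransitive
  have : Nat.card α - p ≤ n + 2 := by omega
  refine MulAction.isMultiplyPretransitive_of_le' this ?_
  have := hp.two_le
  have h3 : n + 2 ≤ Nat.card α := by omega
  rw [ENat.card_eq_coe_natCard]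
  exact_mod_cast h3

open scoped Pointwise in
theorem exists_conj_mem_zpowers {α : Type*} [Fintype α] [DecidableEq α] {G : Subgroup (Perm α)}
    {p : ℕ} (hp : p.Prime) {g g' : Perm α} (hgc : g.IsCycle) (hgp : g.support.card = p)
    (hg : g ∈ G) (hg' : g' ∈ G) (ho : orderOf g' = p) (hs : g'.support ⊆ g.support) :
    ∃ y ∈ G, y.support ⊆ g.support ∧ y * g' * y⁻¹ ∈ Subgroup.zpowers g := by
  classical
  have := Fact.mk hp
  have mem_iff (σ : Perm α) : σ ∈ (ofSubtype : Perm g.support →* Perm α).range ↔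
      σ.support ⊆ g.support := by
    constructor
    · rintro ⟨τ, rfl⟩ x hx
      by_contra h
      rw [mem_support] at hx
      exact hx (ofSubtype_apply_of_not_mem τ h)
    · intro h
      have h1 : ∀ x, σ x ≠ x → x ∈ g.support := fun x hx => h (mem_support.2 hx)
      have h2 : ∀ x, σ x ∈ g.support ↔ x ∈ g.support := by
        intro x
        by_cases hx : σ x = x
        · rw [hx]
        · exact iff_of_true (h (by rw [apply_mem_support, mem_support]; exact hx)) (h1 x hx)
      exact ⟨σ.subtypePerm h2, ofSubtype_subtypePerm h2 h1⟩
  set A := (ofSubtype : Perm g.support →* Perm α).range ⊓ G with hA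
  have hgo : orderOf g = p := by rw [hgc.orderOf, hgp]
  have hgA : g ∈ A := ⟨(mem_iff _).2 subset_rfl, hg⟩
  have hgA' : g' ∈ A := ⟨(mem_iff _).2 hs, hg'⟩
  have hcard : ¬ p ^ 2 ∣ Nat.card A := by
    intro h
    have h1 : Nat.card A ∣ Nat.card (ofSubtype : Perm g.support →* Perm α).range :=
      Subgroup.card_dvd_of_le inf_le_left
    rw [← Nat.card_congr (MonoidHom.ofInjective ofSubtype_injective).toEquiv, Nat.card_perm,
      Nat.card_eq_fintype_card (α := g.support), Fintype.card_coe, hgp] at h1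
    have h2 := h.trans h1
    obtain ⟨q, rfl⟩ : ∃ q, p = q + 1 := ⟨p - 1, by have := hp.pos; omega⟩
    rw [Nat.factorial_succ, pow_two] at h2
    have h3 := Nat.dvd_of_mul_dvd_mul_left (by omega) h2
    rw [hp.dvd_factorial] at h3
    omega
  have syl (x : A) (hx : orderOf x = p) :
      ∃ P : Sylow p A, (P : Subgroup A) = Subgroup.zpowers x := by
    have h1 : Nat.card (Subgroup.zpowers x) = p := by rw [Nat.card_zpowers, hx]
    have h2 : IsPGroup p (Subgroup.zpowers x) := IsPGroup.of_card (n := 1) (by rw [h1, pow_one])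
    refine ⟨h2.toSylow ?_, rfl⟩
    intro h
    apply hcard
    rw [← Subgroup.card_mul_index (Subgroup.zpowers x), h1, pow_two]
    exact mul_dvd_mul_left p h
  obtain ⟨P, hP⟩ := syl ⟨g, hgA⟩ (by rw [Subgroup.orderOf_mk, hgo])
  obtain ⟨Q, hQ⟩ := syl ⟨g', hgA'⟩ (by rw [Subgroup.orderOf_mk, ho])
  obtain ⟨y, hy⟩ := MulAction.exists_smul_eq A Q P
  refine ⟨y, y.2.2, (mem_iff _).1 y.2.1, ?_⟩
  have h1 : y * ⟨g', hgA'⟩ * y⁻¹ ∈ (P : Subgroup A) := by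
    rw [← hy, Sylow.coe_subgroup_smul, hQ]
    exact Subgroup.smul_mem_pointwise_smul _ (MulAut.conj y) _ (Subgroup.mem_zpowers _)
  rw [hP] at h1
  obtain ⟨k, hk⟩ := h1
  exact ⟨k, by simpa using congrArg Subtype.val hk⟩

theorem exists_conj_eq_pow {α : Type*} [Fintype α] [DecidableEq α] {G : Subgroup (Perm α)}
    (hG : MulAction.IsPreprimitive G α) {p : ℕ} (hp : p.Prime) (hp' : p + 3 ≤ Nat.card α)
    {g : Perm α} (hgc : g.IsCycle) (hgp : g.support.card = p) (hg : g ∈ G)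
    {a b : α} (ha : a ∉ g.support) (hb : b ∉ g.support) :
    ∃ u ∈ G, (∀ z ∉ g.support, u z = swap a b z) ∧ ∃ i : ℕ, u * g * u⁻¹ = g ^ i := by
  have ht := isMultiplyPretransitive_of_isCycle_mem hG hp hp' hgc hgp hg
  have hc : Fintype.card {x // x ∉ g.support} = Nat.card α - p := by
    rw [Fintype.card_subtype_compl, Nat.card_eq_fintype_card, Fintype.card_coe, hgp]
  let e : Fin (Nat.card α - p) ≃ {x // x ∉ g.support} := (Fintype.equivFinOfCardEq hc).symm
  obtain ⟨h, hh⟩ := (MulAction.isMultiplyPretransitive_iff.1 ht)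
    (e.toEmbedding.trans (.subtype _)) ((e.toEmbedding.trans (.subtype _)).trans
      (swap a b).toEmbedding)
  have hsw : ∀ z ∉ g.support, swap a b z ∉ g.support := by
    intro z hz
    rw [swap_apply_def]; split_ifs <;> assumption
  have hhz : ∀ z ∉ g.support, (h : Perm α) z = swap a b z := by
    intro z hz
    have := DFunLike.congr_fun hh (e.symm ⟨z, hz⟩)
    simpa [Subgroup.smul_def] using this
  have hs : ((h : Perm α) * g * (h : Perm α)⁻¹).support ⊆ g.support := by
    intro z hz
    by_contra hz'
    rw [mem_support] at hz
    apply hz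
    have h1 : (h : Perm α)⁻¹ z = swap a b z := by
      rw [inv_eq_iff_eq, hhz _ (hsw z hz'), swap_apply_self]
    have h2 := hsw z hz'
    rw [notMem_support] at h2
    rw [mul_apply, mul_apply, h1, h2, hhz _ (hsw z hz'), swap_apply_self]
  obtain ⟨y, hyG, hys, hy⟩ := exists_conj_mem_zpowers hp hgc hgp hg
    (G.mul_mem (G.mul_mem h.2 hg) (G.inv_mem h.2))
    (by rw [← MulAut.conj_apply, MulEquiv.orderOf_eq, hgc.orderOf, hgp]) hs
  refine ⟨y * h, G.mul_mem hyG h.2, fun z hz => ?_, ?_⟩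
  · rw [mul_apply, hhz z hz]
    exact notMem_support.1 fun h => hsw z hz (hys h)
  · rw [← mem_powers_iff_mem_zpowers] at hy
    obtain ⟨i, hi⟩ := hy
    exact ⟨i, by simp only at hi; rw [hi]; group⟩

/-- Jordan's theorem on primitive groups containing a cycle of prime length. -/
theorem alternatingGroup_le_of_isPreprimitive_of_isCycle_mem {α : Type*} [Fintype α]
    [DecidableEq α] {G : Subgroup (Perm α)}
    (hG : MulAction.IsPreprimitive G α) {p : ℕ} (hp : p.Prime) (hp3 : p ≠ 3)
    (hp' : p + 3 ≤ Nat.card α)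
    {g : Perm α} (hgc : g.IsCycle) (hgp : g.support.card = p) (hg : g ∈ G) :
    alternatingGroup α ≤ G := by
  obtain ⟨a, ha, b, hb, c, hc, hab, hac, hbc⟩ : ∃ a ∈ g.supportᶜ, ∃ b ∈ g.supportᶜ,
      ∃ c ∈ g.supportᶜ, a ≠ b ∧ a ≠ c ∧ b ≠ c := by
    rw [← Finset.two_lt_card, Finset.card_compl, hgp, ← Nat.card_eq_fintype_card]
    omega
  rw [Finset.mem_compl] at ha hb hc
  obtain ⟨u, huG, hu, i, hi⟩ := exists_conj_eq_pow hG hp hp' hgc hgp hg ha hb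
  obtain ⟨v, hvG, hv, j, hj⟩ := exists_conj_eq_pow hG hp hp' hgc hgp hg ha hc
  have hsw : ∀ {x y : α}, x ∉ g.support → y ∉ g.support → ∀ z ∉ g.support,
      swap x y z ∉ g.support := by
    intro x y hx hy z hz
    rw [swap_apply_def]; split_ifs <;> assumption
  set r := swap a b * swap a c with hr
  have hr3 : r.IsThreeCycle := isThreeCycle_swap_mul_swap_same hab hac hbc
  have hrinv : r⁻¹ = swap a c * swap a b := by simp [hr]
  have hrs : ∀ z ∉ g.support, r z ∉ g.support := fun z hz => hsw ha hb _ (hsw ha hc _ hz)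
  have hrsup : ∀ z ∈ g.support, r z = z := by
    intro z hz
    have : z ≠ a ∧ z ≠ b ∧ z ≠ c := by
      refine ⟨?_, ?_, ?_⟩ <;> (rintro rfl; contradiction)
    rw [hr, mul_apply, swap_apply_of_ne_of_ne this.1 this.2.2,
      swap_apply_of_ne_of_ne this.1 this.2.1]
  have hdis : Disjoint r g := by
    intro z
    by_cases hz : z ∈ g.support
    · exact .inl (hrsup z hz)
    · exact .inr (notMem_support.1 hz)
  -- the commutator of `u` and `v` centralizes `g`
  set w := (v * u)⁻¹ * (u * v) with hw
  have hwG : w ∈ G := G.mul_mem (G.inv_mem (G.mul_mem hvG huG)) (G.mul_mem huG hvG)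
  have hwg : Commute w g := by
    have h1 : (u * v) * g * (u * v)⁻¹ = g ^ (i * j) := by
      calc (u * v) * g * (u * v)⁻¹ = u * (v * g * v⁻¹) * u⁻¹ := by group
        _ = (u * g * u⁻¹) ^ j := by rw [hj, conj_pow]
        _ = _ := by rw [hi, pow_mul]
    have h2 : (v * u) * g * (v * u)⁻¹ = g ^ (i * j) := by
      calc (v * u) * g * (v * u)⁻¹ = v * (u * g * u⁻¹) * v⁻¹ := by group
        _ = (v * g * v⁻¹) ^ i := by rw [hi, conj_pow]
        _ = _ := by rw [hj, mul_comm i, pow_mul]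
    have h3 := h1.trans h2.symm
    rw [mul_inv_eq_iff_eq_mul] at h3
    rw [hw, Commute, SemiconjBy, mul_assoc, h3]
    group
  have hwz : ∀ z, w z = (v * u)⁻¹ ((u * v) z) := fun z => rfl
  clear_value w r
  obtain ⟨x, hx, hxc⟩ := id hgc
  have hwx : SameCycle g x (w x) := by
    apply hxc
    intro h
    rw [← mul_apply, ← hwg.eq, mul_apply, EmbeddingLike.apply_eq_iff_eq] at h
    exact hx h
  obtain ⟨k, hk⟩ := hwx
  have hwr : w = r ^ 2 * g ^ k := by
    ext z
    by_cases hz : z ∈ g.support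
    · have hz' : (g ^ k) z ∈ g.support := by rwa [zpow_apply_mem_support]
      obtain ⟨l, rfl⟩ := hxc (mem_support.1 hz)
      rw [mul_apply, pow_two, mul_apply, hrsup _ hz', hrsup _ hz', ← mul_apply, ← mul_apply,
        (hwg.zpow_right l).eq, mul_apply, ← hk, ← mul_apply, ← zpow_add, ← zpow_add, add_comm]
    · have hz' : (g ^ k) z = z := by
        rw [← notMem_support]
        exact fun h => hz (support_zpow_le g k h)
      have huv : (u * v) z = r z := by
        rw [mul_apply, hv z hz, hu _ (hsw ha hc z hz), hr, mul_apply]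
      have hvu : (v * u) (r (r z)) = r z := by
        rw [mul_apply, hu _ (hrs _ (hrs _ hz)), hv _ (hsw ha hb _ (hrs _ (hrs _ hz))),
          ← mul_apply, ← hrinv, inv_eq_iff_eq]
      rw [mul_apply, hz', pow_two, mul_apply, hwz, huv, inv_eq_iff_eq, hvu]
  have hcomm : Commute (r ^ 2) (g ^ k) := (hdis.commute.pow_left 2).zpow_right k
  have hwp : w ^ p = r ^ (2 * p) := by
    rw [hwr, hcomm.mul_pow, ← pow_mul, ← zpow_natCast (g ^ k), ← zpow_mul, mul_comm k, zpow_mul,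
      zpow_natCast, ← hgp, ← hgc.orderOf, pow_orderOf_eq_one, one_zpow, mul_one]
  have hrG : r ^ (2 * p) ∈ G := hwp ▸ G.pow_mem hwG p
  have hcop : (2 * p).Coprime (orderOf r) := by
    rw [hr3.orderOf]
    exact Nat.Coprime.mul_left (by norm_num) ((Nat.coprime_primes hp Nat.prime_three).2 hp3)
  obtain ⟨n, hn⟩ := exists_pow_eq_self_of_coprime hcop
  refine alternatingGroup_le_of_isPreprimitive_of_isThreeCycle_mem hG hr3 ?_
  rw [← hn]
  exact G.pow_mem hrG n

end

/-- The coefficient list of `a + c * b` modulo `7`. -/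
def addMul (c : ℕ) (a b : List ℕ) : List ℕ :=
  List.zipWith (fun y z => (y + c * z) % 7) a b

/-- Multiplication of a coefficient list by the variable, modulo the monic polynomial
`X ^ r.length - r` over `ZMod 7`. -/
def shiftMod (r : List ℕ) : List ℕ → List ℕ
  | [] => []
  | h :: t => addMul h (t ++ [0]) r

/-- The lists of the powers `X ^ (7 * (n - 1)), …, X ^ 7, 1` modulo `X ^ r.length - r`. -/
def frobRows (r : List ℕ) : ℕ → List (List ℕ)
  | 0 => []
  | 1 => [List.replicate (r.length - 1) 0 ++ [1]]
  | n + 2 => match frobRows r (n + 1) with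
    | [] => []
    | h :: t => (shiftMod r)^[7] h :: h :: t

/-- The linear combination of the rows in the second list with coefficients in the first. -/
def frobApply (r : List ℕ) : List ℕ → List (List ℕ) → List ℕ
  | c :: a, h :: t => addMul c (frobApply r a t) h
  | _, _ => List.replicate r.length 0

/-- The coefficient list of the variable. -/
def varList (r : List ℕ) : List ℕ := List.replicate (r.length - 2) 0 ++ [1, 0]

/-- The coefficient list of `X ^ 7 ^ n` modulo `X ^ r.length - r`. -/
def frobIter (r : List ℕ) (n : ℕ) : List ℕ :=
  (fun a => frobApply r a (frobRows r r.length))^[n] (varList r)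

/-- The value at `x` of the polynomial whose coefficients, in decreasing degree, are listed. -/
def evalList {A : Type*} [CommSemiring A] (x : A) : List ℕ → A
  | [] => 0
  | c :: l => c * x ^ l.length + evalList x l

section
variable {A : Type*} [CommRing A]

theorem evalList_append_zero (x : A) (l : List ℕ) : evalList x (l ++ [0]) = x * evalList x l := by
  induction l with
  | nil => simp [evalList]
  | cons c l ih => simp [evalList, ih]; ring

theorem evalList_replicate_zero_append (x : A) (n : ℕ) (l : List ℕ) :
    evalList x (List.replicate n 0 ++ l) = evalList x l := by
  induction n with
  | zero => simp
  | succ n ih => simp [List.replicate_succ, evalList, ih]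

theorem evalList_replicate_zero (x : A) (n : ℕ) : evalList x (List.replicate n 0) = 0 := by
  simpa [evalList] using evalList_replicate_zero_append x n []

theorem length_addMul (c : ℕ) {a b : List ℕ} (h : a.length = b.length) :
    (addMul c a b).length = a.length := by simp [addMul, h]

theorem evalList_addMul [CharP A 7] (x : A) (c : ℕ) {a b : List ℕ} (h : a.length = b.length) :
    evalList x (addMul c a b) = evalList x a + c * evalList x b := by
  induction a generalizing b with
  | nil => cases b <;> simp_all [evalList, addMul]
  | cons u a ih =>
    cases b with
    | nil => simp at h
    | cons v b =>
      have h' : a.length = b.length := by simpa using h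
      have e := ih h'
      simp only [addMul] at e
      have hl : (List.zipWith (fun y z => (y + c * z) % 7) a b).length = a.length := by simp [h']
      simp only [addMul, List.zipWith_cons_cons, evalList, hl, e, ← h', ← CharP.cast_eq_mod A 7]
      push_cast
      ring

theorem length_shiftMod {r a : List ℕ} (h : a.length = r.length) :
    (shiftMod r a).length = r.length := by
  cases a with
  | nil => simpa [shiftMod] using h
  | cons u a => rw [shiftMod, length_addMul] <;> simp_all

theorem evalList_shiftMod [CharP A 7] {x : A} {r : List ℕ} (hx : x ^ r.length = evalList x r)
    {a : List ℕ} (h : a.length = r.length) :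
    evalList x (shiftMod r a) = x * evalList x a := by
  cases a with
  | nil =>
    rw [← h] at hx
    simp [shiftMod, evalList]
  | cons u a =>
    rw [shiftMod, evalList_addMul _ _ (by simpa using h), evalList_append_zero, ← hx, ← h,
      evalList, List.length_cons]
    ring

theorem length_shiftMod_iterate {r a : List ℕ} (h : a.length = r.length) (n : ℕ) :
    ((shiftMod r)^[n] a).length = r.length := by
  induction n with
  | zero => exact h
  | succ n ih => rw [Function.iterate_succ_apply', length_shiftMod ih]

theorem evalList_shiftMod_iterate [CharP A 7] {x : A} {r : List ℕ}
    (hx : x ^ r.length = evalList x r) {a : List ℕ} (h : a.length = r.length) (n : ℕ) :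
    evalList x ((shiftMod r)^[n] a) = x ^ n * evalList x a := by
  induction n with
  | zero => simp
  | succ n ih =>
    rw [Function.iterate_succ_apply', evalList_shiftMod hx (length_shiftMod_iterate h n), ih]
    ring

/-- `R` lists representatives of `x ^ (7 * (n - 1)), …, x ^ 7, 1`. -/
def IsFrobRows (x : A) (r : List ℕ) : List (List ℕ) → Prop
  | [] => True
  | h :: t => (h.length = r.length ∧ evalList x h = x ^ (7 * t.length)) ∧ IsFrobRows x r t

theorem isFrobRows_frobRows [CharP A 7] {x : A} {r : List ℕ} (hx : x ^ r.length = evalList x r)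
    (hr : 2 ≤ r.length) (n : ℕ) :
    (frobRows r n).length = n ∧ IsFrobRows x r (frobRows r n) := by
  match n with
  | 0 => simp [frobRows, IsFrobRows]
  | 1 =>
    simp only [frobRows, IsFrobRows, evalList_replicate_zero_append]
    simp [evalList]
    omega
  | n + 2 =>
    obtain ⟨h1, h2⟩ := isFrobRows_frobRows hx hr (n + 1)
    rw [frobRows]
    cases hR : frobRows r (n + 1) with
    | nil => simp [hR] at h1
    | cons h t =>
      rw [hR] at h1 h2
      refine ⟨by simpa using h1, ⟨length_shiftMod_iterate h2.1.1 7, ?_⟩, h2⟩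
      rw [evalList_shiftMod_iterate hx h2.1.1, h2.1.2, List.length_cons]
      ring

theorem evalList_frobApply [CharP A 7] {x : A} {r : List ℕ} {R : List (List ℕ)}
    (hR : IsFrobRows x r R) {a : List ℕ} (ha : a.length = R.length) :
    (frobApply r a R).length = r.length ∧ evalList x (frobApply r a R) = evalList x a ^ 7 := by
  have : Fact (Nat.Prime 7) := ⟨by norm_num⟩
  induction a generalizing R with
  | nil => cases R <;> simp_all [frobApply, evalList, evalList_replicate_zero]
  | cons c a ih =>
    cases R with
    | nil => simp at ha
    | cons h t =>
      have ha' : a.length = t.length := by simpa using ha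
      obtain ⟨h1, h2⟩ := ih hR.2 ha'
      have h3 : (frobApply r a t).length = h.length := by rw [h1, hR.1.1]
      refine ⟨by rw [frobApply, length_addMul c h3, h1], ?_⟩
      have hc : (c : A) ^ 7 = c := by
        rw [← frobenius_def]
        exact map_natCast (frobenius A 7) c
      rw [frobApply, evalList_addMul x c h3, h2, hR.1.2, evalList, add_pow_char, mul_pow, ← ha',
        ← pow_mul, hc]
      ring

theorem evalList_frobIter [CharP A 7] {x : A} {r : List ℕ} (hx : x ^ r.length = evalList x r)
    (hr : 2 ≤ r.length) (n : ℕ) :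
    (frobIter r n).length = r.length ∧ evalList x (frobIter r n) = x ^ 7 ^ n := by
  induction n with
  | zero =>
    simp only [frobIter, Function.iterate_zero, id, varList, evalList_replicate_zero_append]
    simp [evalList]
    omega
  | succ n ih =>
    obtain ⟨h1, h2⟩ := isFrobRows_frobRows hx hr r.length
    rw [frobIter] at ih ⊢
    rw [Function.iterate_succ_apply']
    obtain ⟨h3, h4⟩ := evalList_frobApply h2 (ih.1.trans h1.symm)
    exact ⟨h3, by rw [h4, ih.2, ← pow_mul, ← pow_succ]⟩

theorem pow_eq_self_of_frobIter [CharP A 7] {x : A} {r : List ℕ}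
    (hx : x ^ r.length = evalList x r) (hr : 2 ≤ r.length) {n : ℕ}
    (h : frobIter r n = varList r) : x ^ 7 ^ n = x := by
  rw [← (evalList_frobIter hx hr n).2, h, varList, evalList_replicate_zero_append]
  simp [evalList]

theorem map_evalList {B : Type*} [CommRing B] (φ : A →+* B) (x : A) (l : List ℕ) :
    φ (evalList x l) = evalList (φ x) l := by
  induction l with
  | nil => simp [evalList]
  | cons c l ih => simp [evalList, ih]

theorem degree_evalList_X_lt (l : List ℕ) : degree (evalList (X : A[X]) l) < l.length := by
  induction l with
  | nil => simp [evalList]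
  | cons c l ih =>
    have hl : (l.length : WithBot ℕ) < (c :: l).length := by
      exact_mod_cast Nat.lt_succ_self _
    refine (degree_add_le _ _).trans_lt (max_lt ?_ (ih.trans hl))
    rw [← C_eq_natCast]
    exact (degree_C_mul_X_pow_le _ _).trans_lt hl

end

theorem injective_of_eval_derivative_prod_ne_zero {R k : Type*} [Fintype R]
    [DecidableEq R] [Field k] (ρ : R → k)
    (h : ∀ c, eval c (∏ i, (X - C (ρ i))) = 0 →
      eval c (derivative (∏ i, (X - C (ρ i)))) ≠ 0) : ρ.Injective := by
  intro i j hij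
  by_contra hne
  have hj : j ∈ Finset.univ.erase i := by simp [Ne.symm hne]
  have hP : ∏ i, (X - C (ρ i)) = (X - C (ρ i)) *
      ((X - C (ρ i)) * ∏ l ∈ (Finset.univ.erase i).erase j, (X - C (ρ l))) := by
    rw [← Finset.mul_prod_erase _ _ (Finset.mem_univ i), ← Finset.mul_prod_erase _ _ hj, hij]
  exact h (ρ i) (by simp [hP]) (by simp [hP, derivative_mul])

section
variable {R k : Type*} [Fintype R] [DecidableEq R] [Field k] [CharP k 7]

open Equiv.Perm in
theorem exists_isCycle_pow (σ : Equiv.Perm R) (ρ : R → k) (hσ : ∀ r, ρ (σ r) = ρ r ^ 7)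
    (r s : List ℕ) (hr : r.length.Prime) (hs : 2 ≤ s.length)
    (hP : ∏ i, (X - C (ρ i)) = (X ^ r.length - evalList X r) * (X ^ s.length - evalList X s))
    (hr1 : frobIter r r.length = varList r) (hr2 : ∀ a : ZMod 7, a ^ r.length ≠ evalList a r)
    (h : Fintype.card R < 2 * r.length ∨
      (ρ.Injective ∧ ∃ N, frobIter s N = varList s ∧ ¬ r.length ∣ N)) :
    ∃ n, (σ ^ n).IsCycle ∧ (σ ^ n).support.card = r.length := by
  have : Fact (Nat.Prime 7) := ⟨by norm_num⟩
  have hpow : ∀ n i, ρ ((σ ^ n) i) = ρ i ^ 7 ^ n := by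
    intro n i
    induction n with
    | zero => simp
    | succ n ih => rw [pow_succ', mul_apply, hσ, ih, ← pow_mul, ← pow_succ]
  have heval : ∀ (c : k) (l : List ℕ), eval c (X ^ l.length - evalList X l) =
      c ^ l.length - evalList c l := by
    intro c l
    have := map_evalList (evalRingHom c) X l
    simp only [coe_evalRingHom, eval_X] at this
    simp [this]
  have hroot : ∀ c, eval c (∏ i, (X - C (ρ i))) = 0 ↔ ∃ i, ρ i = c := by
    intro c
    rw [eval_prod, Finset.prod_eq_zero_iff]
    simp only [eval_sub, eval_X, eval_C, sub_eq_zero, Finset.mem_univ, true_and]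
    exact exists_congr fun i => eq_comm
  have hmonic : ∀ l : List ℕ, 0 < l.length → (X ^ l.length - evalList (X : k[X]) l).Monic ∧
      (X ^ l.length - evalList (X : k[X]) l).natDegree = l.length := by
    intro l hl
    have := degree_evalList_X_lt (A := k) l
    exact ⟨monic_X_pow_sub this, by
      refine natDegree_eq_of_degree_eq_some ?_
      rw [degree_sub_eq_left_of_degree_lt] <;> simp [this]⟩
  have hr0 := hmonic r hr.pos
  have hs0 := hmonic s (by omega)
  -- a root of the first factor
  obtain ⟨c, hc⟩ : ∃ c, eval c (X ^ r.length - evalList (X : k[X]) r) = 0 := by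
    have hsp : (∏ i, (X - C (ρ i))).Splits := Splits.prod fun i _ => Splits.X_sub_C _
    have hne : (∏ i, (X - C (ρ i))) ≠ 0 := Finset.prod_ne_zero_iff.2 fun i _ => X_sub_C_ne_zero _
    refine (hsp.of_dvd hne ⟨_, hP⟩).exists_eval_eq_zero ?_
    rw [degree_eq_natDegree hr0.1.ne_zero, hr0.2]
    exact_mod_cast hr.ne_zero
  obtain ⟨i, rfl⟩ := (hroot c).1 (by rw [hP, eval_mul, hc, zero_mul])
  rw [heval, sub_eq_zero] at hc
  have hper : ρ i ^ 7 ^ r.length = ρ i := pow_eq_self_of_frobIter hc hr.two_le hr1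
  have hnot : ρ i ^ 7 ≠ ρ i := by
    intro h
    let := ZMod.algebra k 7
    rw [← Subfield.mem_bot_iff_pow_eq_self, ← ZMod.fieldRange_castHom_eq_bot 7] at h
    obtain ⟨a, ha⟩ := h
    apply hr2 a
    apply (ZMod.castHom dvd_rfl k).injective
    rw [map_pow, map_evalList, ha, hc]
  have hdvd : r.length ∣ orderOf σ := by
    by_contra hnd
    apply hnot
    have h1 : Function.IsPeriodicPt (fun x : k => x ^ 7) r.length (ρ i) := by
      rw [Function.IsPeriodicPt, Function.IsFixedPt, pow_iterate]
      exact hper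
    have h2 : Function.IsPeriodicPt (fun x : k => x ^ 7) (orderOf σ) (ρ i) := by
      rw [Function.IsPeriodicPt, Function.IsFixedPt, pow_iterate]
      change ρ i ^ 7 ^ orderOf σ = ρ i
      rw [← hpow, pow_orderOf_eq_one, one_apply]
    have h3 := h1.gcd h2
    rw [(hr.coprime_iff_not_dvd).2 hnd] at h3
    exact h3
  suffices ∃ n, orderOf (σ ^ n) = r.length ∧ (σ ^ n).support.card < 2 * r.length by
    obtain ⟨n, h1, h2⟩ := this
    have h3 : (σ ^ n).IsCycle := isCycle_of_prime_order (h1 ▸ hr) (by rwa [h1])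
    exact ⟨n, h3, by rw [← h3.orderOf, h1]⟩
  rcases h with h | ⟨hinj, N, hN, hNr⟩
  · refine ⟨orderOf σ / r.length, ?_, (Finset.card_le_univ _).trans_lt h⟩
    exact orderOf_pow_orderOf_div (orderOf_pos σ).ne' hdvd
  · have hfix : ∀ j, (σ ^ N) j ≠ j → ρ j ^ r.length = evalList (ρ j) r := by
      intro j hj
      have h1 := (hroot (ρ j)).2 ⟨j, rfl⟩
      rw [hP, eval_mul, mul_eq_zero, heval, heval, sub_eq_zero, sub_eq_zero] at h1
      refine h1.resolve_right fun h2 => hj (hinj ?_)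
      rw [hpow, pow_eq_self_of_frobIter h2 hs hN]
    refine ⟨N, ?_, ?_⟩
    · have := Fact.mk hr
      apply orderOf_eq_prime
      · rw [← pow_mul]
        ext j
        rw [one_apply]
        apply hinj
        by_cases hj : (σ ^ N) j = j
        · rw [pow_mul, pow_apply_eq_self_of_apply_eq_self hj]
        · have h1 := (show Function.IsPeriodicPt (fun x : k => x ^ 7) r.length (ρ j) by
            rw [Function.IsPeriodicPt, Function.IsFixedPt, pow_iterate]
            exact pow_eq_self_of_frobIter (hfix j hj) hr.two_le hr1).const_mul N
          rw [Function.IsPeriodicPt, Function.IsFixedPt, pow_iterate] at h1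
          rw [hpow]
          exact h1
      · intro h
        exact hNr (hdvd.trans (orderOf_dvd_of_pow_eq_one h))
    · classical
      have h1 : (σ ^ N).support.image ρ ⊆
          (X ^ r.length - evalList (X : k[X]) r).roots.toFinset := by
        intro x hx
        obtain ⟨j, hj, rfl⟩ := Finset.mem_image.1 hx
        rw [Multiset.mem_toFinset, mem_roots hr0.1.ne_zero, IsRoot, heval, sub_eq_zero]
        exact hfix j (mem_support.1 hj)
      calc (σ ^ N).support.card = ((σ ^ N).support.image ρ).card :=
            (Finset.card_image_of_injective _ hinj).symm
        _ ≤ _ := Finset.card_le_card h1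
        _ ≤ _ := Multiset.toFinset_card_le _
        _ ≤ r.length := (card_roots' _).trans hr0.2.le
        _ < _ := by have := hr.pos; omega

theorem exists_isCycle_pow_card_seventeen (σ : Equiv.Perm R) (ρ : R → k)
    (hσ : ∀ i, ρ (σ i) = ρ i ^ 7) (hR : Fintype.card R = 23)
    (hP : ∏ i, (X - C (ρ i)) = X ^ 23 - C ((4 : ℤ) : k) * X ^ 22 + C ((4 : ℤ) : k)) :
    ∃ n, (σ ^ n).IsCycle ∧ (σ ^ n).support.card = 17 := by
  have h7 : (7 : k[X]) = 0 := CharP.cast_eq_zero k[X] 7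
  refine exists_isCycle_pow σ ρ hσ [3, 4, 3, 3, 6, 4, 5, 0, 0, 3, 5, 4, 1, 6, 4, 4, 6]
    [1, 6, 5, 4, 5, 3] (by norm_num) (by simp) ?_ (by decide +kernel)
    (by decide +kernel) (.inl (by simp [hR]))
  simp only [Int.cast_ofNat, map_ofNat] at hP
  rw [hP]
  simp only [evalList, List.length_cons, List.length_nil]
  push_cast
  linear_combination (-1) * (2 + 6 * X ^ 1 + 8 * X ^ 2 + 12 * X ^ 3 + 15 * X ^ 4 + 13 * X ^ 5 +
      13 * X ^ 6 + 13 * X ^ 7 + 9 * X ^ 8 + 8 * X ^ 9 + 9 * X ^ 10 + 8 * X ^ 11 +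
      8 * X ^ 12 + 11 * X ^ 13 + 14 * X ^ 14 + 14 * X ^ 15 + 13 * X ^ 16 +
      9 * X ^ 17 + 6 * X ^ 18 + 5 * X ^ 19 + 2 * X ^ 20 + (-1) * X ^ 21) * h7

theorem exists_isCycle_pow_card_seven (σ : Equiv.Perm R) (ρ : R → k)
    (hσ : ∀ i, ρ (σ i) = ρ i ^ 7) (hρ : ρ.Injective)
    (hP : ∏ i, (X - C (ρ i)) = X ^ 23 - C ((6 : ℤ) : k) * X ^ 22 + C ((1 : ℤ) : k)) :
    ∃ n, (σ ^ n).IsCycle ∧ (σ ^ n).support.card = 7 := by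
  have h7 : (7 : k[X]) = 0 := CharP.cast_eq_zero k[X] 7
  refine exists_isCycle_pow σ ρ hσ [5, 2, 4, 3, 4, 1, 4]
    [1, 3, 6, 2, 5, 2, 6, 0, 5, 3, 1, 0, 1, 6, 3, 2] (by norm_num) (by simp) ?_ (by decide +kernel)
    (by decide +kernel) (.inr ⟨hρ, 12, by decide +kernel, by norm_num⟩)
  simp only [Int.cast_ofNat, Int.cast_one, map_ofNat, map_one] at hP
  rw [hP]
  simp only [evalList, List.length_cons, List.length_nil]
  push_cast
  linear_combination (-1) * (1 + 2 * X ^ 1 + 5 * X ^ 2 + 4 * X ^ 3 + 6 * X ^ 4 + 6 * X ^ 5 +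
      8 * X ^ 6 + 8 * X ^ 7 + 7 * X ^ 8 + 8 * X ^ 9 + 6 * X ^ 10 + 11 * X ^ 11 + 9 * X ^ 12 +
      14 * X ^ 13 + 8 * X ^ 14 + 13 * X ^ 15 + 7 * X ^ 16 + 9 * X ^ 17 +
      4 * X ^ 18 + 5 * X ^ 19 + 1 * X ^ 20) * h7

theorem exists_isCycle_pow_card_nineteen (σ : Equiv.Perm R) (ρ : R → k)
    (hσ : ∀ i, ρ (σ i) = ρ i ^ 7) (hR : Fintype.card R = 23)
    (hP : ∏ i, (X - C (ρ i)) = X ^ 23 - C ((5 : ℤ) : k) * X ^ 22 + C ((2 : ℤ) : k)) :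
    ∃ n, (σ ^ n).IsCycle ∧ (σ ^ n).support.card = 19 := by
  have h7 : (7 : k[X]) = 0 := CharP.cast_eq_zero k[X] 7
  refine exists_isCycle_pow σ ρ hσ [5, 5, 2, 0, 0, 0, 2, 0, 4, 2, 3, 1, 5, 0, 0, 6, 5, 5, 2]
    [0, 2, 1, 1] (by norm_num) (by simp) ?_ (by decide +kernel)
    (by decide +kernel) (.inl (by simp [hR]))
  simp only [Int.cast_ofNat, map_ofNat] at hP
  rw [hP]
  simp only [evalList, List.length_cons, List.length_nil]
  push_cast
  linear_combination (-1) * (1 * X ^ 1 + 2 * X ^ 2 + 3 * X ^ 3 + 2 * X ^ 4 + 1 * X ^ 5 + 2 * X ^ 8 +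
      1 * X ^ 9 + 1 * X ^ 10 + 1 * X ^ 11 + 1 * X ^ 12 + 1 * X ^ 17 + 2 * X ^ 18 +
      2 * X ^ 19 + 1 * X ^ 20 + (-1) * X ^ 21) * h7

theorem exists_isCycle_pow_card_eleven (σ : Equiv.Perm R) (ρ : R → k)
    (hσ : ∀ i, ρ (σ i) = ρ i ^ 7) (hρ : ρ.Injective)
    (hP : ∏ i, (X - C (ρ i)) = X ^ 23 - C ((1 : ℤ) : k) * X ^ 22 + C ((1 : ℤ) : k)) :
    ∃ n, (σ ^ n).IsCycle ∧ (σ ^ n).support.card = 11 := by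
  have h7 : (7 : k[X]) = 0 := CharP.cast_eq_zero k[X] 7
  refine exists_isCycle_pow σ ρ hσ [1, 3, 5, 2, 4, 1, 5, 2, 5, 6, 1]
    [0, 4, 6, 2, 1, 2, 3, 2, 3, 3, 1, 1] (by norm_num) (by simp) ?_ (by decide +kernel)
    (by decide +kernel) (.inr ⟨hρ, 8, by decide +kernel, by norm_num⟩)
  simp only [Int.cast_one, map_one] at hP
  rw [hP]
  simp only [evalList, List.length_cons, List.length_nil]
  push_cast
  linear_combination (-1) * (1 * X ^ 1 + 2 * X ^ 2 + 4 * X ^ 3 + 6 * X ^ 4 + 6 * X ^ 5 +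
      8 * X ^ 6 + 8 * X ^ 7 + 8 * X ^ 8 + 10 * X ^ 9 + 14 * X ^ 10 + 15 * X ^ 11 +
      11 * X ^ 12 + 9 * X ^ 13 + 7 * X ^ 14 + 6 * X ^ 15 + 5 * X ^ 16 +
      6 * X ^ 17 + 5 * X ^ 18 + 2 * X ^ 19 + (-1) * X ^ 20 + (-1) * X ^ 21) * h7

theorem injective_of_prod_eq (ρ : R → k) (a : k)
    (hP : ∏ i, (X - C (ρ i)) = X ^ 23 - C a * X ^ 22 + 1) (ha : 5 * a ^ 23 + 1 ≠ 0) :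
    ρ.Injective := by
  have h7 : (7 : k) = 0 := CharP.cast_eq_zero k 7
  apply injective_of_eval_derivative_prod_ne_zero
  intro c h1 h2
  rw [hP] at h1 h2
  simp only [derivative_add, derivative_sub, derivative_mul, derivative_X_pow, derivative_C,
    derivative_one, eval_add, eval_sub, eval_mul, eval_pow, eval_X, eval_C, eval_one,
    eval_zero] at h1 h2
  have h3 : c ^ 21 * (c - 4 * a) = 0 := by
    push_cast at h2
    linear_combination 4 * h2 + (- 13 * c ^ 22 + 12 * a * c ^ 21) * h7
  rcases mul_eq_zero.1 h3 with h4 | h4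
  · simp [pow_eq_zero_iff] at h4
    simp [h4] at h1
  · have h5 := sub_eq_zero.1 h4
    subst h5
    apply ha
    linear_combination h1 - a ^ 23 * 7539508304749 * h7

/-- The Frobenius at `7` acts on the roots with a power that is a cycle of prime length. -/
theorem exists_isCycle_pow_of_card_eq (m : ℤ) (σ : Equiv.Perm R) (ρ : R → k)
    (hσ : ∀ i, ρ (σ i) = ρ i ^ 7) (hR : Fintype.card R = 23)
    (hP : ∏ i, (X - C (ρ i)) = X ^ 23 - C ((23 * (m ^ 2 + 23) : ℤ) : k) * X ^ 22 +
      C ((23 * (22 * (m ^ 2 + 23)) ^ 22 : ℤ) : k)) :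
    ∃ p n, p.Prime ∧ p ≠ 3 ∧ p + 3 ≤ 23 ∧ (σ ^ n).IsCycle ∧ (σ ^ n).support.card = p := by
  have key : ∀ r a b : ℤ, m ≡ r [ZMOD 7] → 23 * (r ^ 2 + 23) ≡ a [ZMOD 7] →
      23 * (22 * (r ^ 2 + 23)) ^ 22 ≡ b [ZMOD 7] →
      ∏ i, (X - C (ρ i)) = X ^ 23 - C (a : k) * X ^ 22 + C (b : k) := by
    intro r a b hr ha hb
    have h1 : 23 * (m ^ 2 + 23) ≡ a [ZMOD 7] := Int.ModEq.trans (by gcongr) ha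
    have h2 : 23 * (22 * (m ^ 2 + 23)) ^ 22 ≡ b [ZMOD 7] := Int.ModEq.trans (by gcongr) hb
    rw [hP, (CharP.intCast_eq_intCast k 7).2 h1, (CharP.intCast_eq_intCast k 7).2 h2]
  have h7 : (7 : k) = 0 := CharP.cast_eq_zero k 7
  have h1 : m % 7 = 0 ∨ (m % 7 = 1 ∨ m % 7 = 6) ∨ (m % 7 = 2 ∨ m % 7 = 5) ∨
    (m % 7 = 3 ∨ m % 7 = 4) := by omega
  rcases h1 with h | h | h | h
  · have hP' := key 0 4 4 (by simpa [Int.ModEq] using h) (by decide) (by decide)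
    obtain ⟨n, hn⟩ := exists_isCycle_pow_card_seventeen σ ρ hσ hR hP'
    exact ⟨17, n, by norm_num, by norm_num, by norm_num, hn⟩
  · have hP' : ∏ i, (X - C (ρ i)) = X ^ 23 - C ((6 : ℤ) : k) * X ^ 22 + C ((1 : ℤ) : k) := by
      rcases h with h | h
      · exact key 1 6 1 h (by decide) (by decide)
      · exact key 6 6 1 h (by decide) (by decide)
    have hρ := injective_of_prod_eq ρ 6 (by simpa using hP') (by
      intro h; apply one_ne_zero (α := k)
      linear_combination 5 * h - 2820465082334295772 * h7)
    obtain ⟨n, hn⟩ := exists_isCycle_pow_card_seven σ ρ hσ hρ hP'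
    exact ⟨7, n, by norm_num, by norm_num, by norm_num, hn⟩
  · have hP' : ∏ i, (X - C (ρ i)) = X ^ 23 - C ((5 : ℤ) : k) * X ^ 22 + C ((2 : ℤ) : k) := by
      rcases h with h | h
      · exact key 2 5 2 h (by decide) (by decide)
      · exact key 5 5 2 h (by decide) (by decide)
    obtain ⟨n, hn⟩ := exists_isCycle_pow_card_nineteen σ ρ hσ hR hP'
    exact ⟨19, n, by norm_num, by norm_num, by norm_num, hn⟩
  · have hP' : ∏ i, (X - C (ρ i)) = X ^ 23 - C ((1 : ℤ) : k) * X ^ 22 + C ((1 : ℤ) : k) := by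
      rcases h with h | h
      · exact key 3 1 1 h (by decide) (by decide)
      · exact key 4 1 1 h (by decide) (by decide)
    have hρ := injective_of_prod_eq ρ 1 (by simpa using hP') (by
      intro h; apply one_ne_zero (α := k)
      linear_combination h7 - h)
    obtain ⟨n, hn⟩ := exists_isCycle_pow_card_eleven σ ρ hσ hρ hP'
    exact ⟨11, n, by norm_num, by norm_num, by norm_num, hn⟩

end

open NumberField in
theorem exists_frobenius (K : Type*) [Field K] [NumberField K] [IsGalois ℚ K]
    (p : ℕ) (hp : p.Prime) :
    ∃ (Q : Ideal (𝓞 K)) (_ : Q.IsMaximal) (σ : K ≃ₐ[ℚ] K), CharP (𝓞 K ⧸ Q) p ∧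
      ∀ x : 𝓞 K, Ideal.Quotient.mk Q (σ • x) = Ideal.Quotient.mk Q x ^ p := by
  have : Fact p.Prime := ⟨hp⟩
  have h0 : Prime (p : ℤ) := Nat.prime_iff_prime_int.1 hp
  have hmax : (Ideal.span {(p : ℤ)}).IsMaximal :=
    PrincipalIdealRing.isMaximal_of_irreducible h0.irreducible
  obtain ⟨Q, hQ, hQp⟩ := Ideal.exists_maximal_ideal_liesOver_of_isIntegral (S := 𝓞 K)
    (Ideal.span {(p : ℤ)})
  have hQ0 : Q ≠ ⊥ := Ideal.ne_bot_of_liesOver_of_ne_bot (p := Ideal.span {(p : ℤ)})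
    (by simpa using h0.ne_zero) Q
  have : Finite (𝓞 K ⧸ Q) := Ideal.finiteQuotientOfFreeOfNeBot Q hQ0
  obtain ⟨σ, hσ⟩ := IsArithFrobAt.exists_of_isInvariant ℤ (K ≃ₐ[ℚ] K) Q
  have hcard : Nat.card (ℤ ⧸ Q.under ℤ) = p := by
    rw [← hQp.over, Nat.card_congr (Int.quotientSpanNatEquivZMod p).toEquiv, Nat.card_zmod]
  refine ⟨Q, hQ, σ, ?_, fun x => ?_⟩
  · have hpQ : (p : 𝓞 K) ∈ Q := by
      have h1 : (p : ℤ) ∈ Q.under ℤ := hQp.over ▸ Ideal.mem_span_singleton_self _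
      simpa using h1
    apply ringChar.of_eq
    apply CharP.ringChar_of_prime_eq_zero hp
    rw [← map_natCast (Ideal.Quotient.mk Q)]
    exact Ideal.Quotient.eq_zero_iff_mem.2 hpQ
  · have := hσ.mk_apply x
    rw [hcard] at this
    exact this

theorem irreducible_family (m : ℤ) (hm : ¬ (23 : ℤ) ∣ m) :
    Irreducible (C (22 * (m : ℚ) ^ 2 + 506) * X ^ 23 - C (23 * (m : ℚ) ^ 2 + 529) * X ^ 22 +
      C 23 : ℚ[X]) := by
  have h23 : Prime (23 : ℤ) := by norm_num
  set a : ℤ := 22 * m ^ 2 + 506 with ha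
  set b : ℤ := m ^ 2 + 23 with hb
  have hna : ¬ (23 : ℤ) ∣ a := by
    intro h
    refine hm (h23.dvd_of_dvd_pow (n := 2) ?_)
    rw [ha] at h
    omega
  have ha0 : a ≠ 0 := by rintro h; exact hna (h ▸ dvd_zero _)
  set F : ℤ[X] := C a * X ^ 23 - C (23 * b) * X ^ 22 + C 23 with hF
  have hFmap : F.map (Int.castRingHom ℚ) = C (22 * (m : ℚ) ^ 2 + 506) * X ^ 23 -
      C (23 * (m : ℚ) ^ 2 + 529) * X ^ 22 + C 23 := by
    simp only [hF, ha, hb, Polynomial.map_add, Polynomial.map_sub, Polynomial.map_mul,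
      Polynomial.map_pow, map_X, map_C, Int.coe_castRingHom]
    push_cast
    ring_nf
  have hcoeff : ∀ n, F.coeff n = if n = 23 then a else if n = 22 then - (23 * b) else
      if n = 0 then 23 else 0 := by
    intro n
    simp only [hF, coeff_add, coeff_sub, coeff_C_mul, coeff_X_pow, coeff_C]
    split_ifs <;> omega
  have hdeg : F.natDegree = 23 := by
    apply natDegree_eq_of_le_of_coeff_ne_zero
    · rw [hF]; compute_degree
    · simpa [hcoeff] using ha0
  have hprim : F.IsPrimitive := by
    intro r hr
    rw [C_dvd_iff_dvd_coeff] at hr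
    have h1 := hr 23
    have h2 := hr 0
    simp only [hcoeff] at h1 h2
    norm_num at h1 h2
    have h3 := (h23.irreducible.dvd_iff).1 h2
    refine h3.resolve_right fun h => hna (h.dvd.trans h1)
  rw [← hFmap, ← IsPrimitive.Int.irreducible_iff_irreducible_map_cast hprim]
  have hF0 : F ≠ 0 := by rintro h; simp [h] at hdeg
  refine irreducible_of_eisenstein_criterion (P := Ideal.span {(23 : ℤ)})
    ((Ideal.span_singleton_prime h23.ne_zero).2 h23) ?_ ?_ ?_ ?_ hprim
  · rw [leadingCoeff, hdeg, hcoeff, Ideal.mem_span_singleton]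
    exact hna
  · intro n hn
    rw [degree_eq_natDegree hF0, hdeg] at hn
    have hn' : n < 23 := by exact_mod_cast hn
    rw [hcoeff, Ideal.mem_span_singleton, if_neg hn'.ne]
    split_ifs <;> simp
  · rw [degree_eq_natDegree hF0, hdeg]; norm_num
  · rw [hcoeff, Ideal.span_singleton_pow, Ideal.mem_span_singleton]
    norm_num

open Matrix in
theorem det_vandermonde_sq {R : Type*} [CommRing R] {n : ℕ} (v : Fin n → R) :
    (vandermonde v).det ^ 2 = (∏ i : Fin n, (-1) ^ (Finset.Ioi i).card) *
      ∏ i, eval (v i) (derivative (∏ j, (X - C (v j)))) := by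
  have h : ∀ i, eval (v i) (derivative (∏ j, (X - C (v j)))) = ∏ j ∈ {i}ᶜ, (v i - v j) := by
    intro i
    have := Lagrange.eval_nodal_derivative_eval_node_eq (v := v) (Finset.mem_univ i)
    simp only [Lagrange.nodal, eval_prod, eval_sub, eval_X, eval_C] at this
    rw [this, Finset.compl_singleton]
  simp_rw [h]
  rw [← Finset.prod_prod_Ioi_mul_eq_prod_prod_off_diag (fun i j => v j - v i), det_vandermonde,
    pow_two, ← Finset.prod_mul_distrib, ← Finset.prod_mul_distrib]
  refine Finset.prod_congr rfl fun i _ => ?_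
  rw [← Finset.prod_const, ← Finset.prod_mul_distrib, ← Finset.prod_mul_distrib]
  exact Finset.prod_congr rfl fun j _ => by ring

open Matrix in
theorem sign_eq_one_of_det_vandermonde {R : Type*} [CommRing R] [IsDomain R] [CharZero R]
    {n : ℕ} {v : Fin n → R}
    (hv : v.Injective) (σ : R →+* R) (π : Equiv.Perm (Fin n)) (h : ∀ i, σ (v i) = v (π i))
    (hσ : σ (vandermonde v).det = (vandermonde v).det) : Equiv.Perm.sign π = 1 := by
  have h1 : σ (vandermonde v).det = Equiv.Perm.sign π * (vandermonde v).det := by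
    rw [← det_permute, RingHom.map_det]
    congr 1
    ext i j
    simp [vandermonde_apply, h]
  rw [hσ] at h1
  have h2 := det_vandermonde_ne_zero_iff.2 hv
  rcases Int.units_eq_one_or (Equiv.Perm.sign π) with h3 | h3
  · exact h3
  · rw [h3] at h1
    exfalso
    apply h2
    simpa [eq_neg_iff_add_eq_zero, ← two_mul] using h1

open Matrix in
theorem det_vandermonde_sq_of_prod_eq {R : Type*} [Field R] (m : R) (v : Fin 23 → R)
    (hP : ∏ i, (X - C (v i)) = X ^ 23 - C (23 * (m ^ 2 + 23)) * X ^ 22 +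
      C (23 * (22 * (m ^ 2 + 23)) ^ 22)) :
    (vandermonde v).det ^ 2 = (23 ^ 22 * ((22 * (m ^ 2 + 23)) ^ 22) ^ 11 * m) ^ 2 := by
  obtain ⟨t, ht⟩ : ∃ t, t = m ^ 2 + 23 := ⟨_, rfl⟩
  rw [← ht] at hP ⊢
  have h1 : ∏ i, v i = - (23 * (22 * t) ^ 22) := by
    have := congrArg (eval 0) hP
    simp only [eval_prod, eval_sub, eval_X, eval_C, zero_sub, Finset.prod_neg, Finset.card_fin,
      eval_add, eval_pow, eval_mul] at this
    linear_combination -this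
  have h2 : ∏ i, (v i - 22 * t) = (22 * t) ^ 22 * m ^ 2 := by
    have := congrArg (eval (22 * t)) hP
    simp only [eval_prod, eval_sub, eval_X, eval_C, eval_add, eval_pow, eval_mul] at this
    rw [Finset.prod_congr rfl fun i _ => (neg_sub (v i) (22 * t)).symm, Finset.prod_neg,
      Finset.card_fin] at this
    linear_combination -this + (22 * t) ^ 22 * ht
  have h3 : ∀ i, eval (v i) (derivative (∏ j, (X - C (v j)))) =
      23 * v i ^ 21 * (v i - 22 * t) := by
    intro i
    rw [hP]
    simp only [derivative_add, derivative_sub, derivative_mul, derivative_X_pow, derivative_C,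
      eval_add, eval_sub, eval_mul, eval_pow, eval_X, eval_C, eval_zero]
    push_cast
    ring
  have h4 : ∏ i : Fin 23, (-1 : R) ^ (Finset.Ioi i).card = -1 := by
    rw [Finset.prod_pow_eq_pow_sum]
    have : ∑ i : Fin 23, (Finset.Ioi i).card = 253 := by decide
    rw [this]; norm_num
  rw [det_vandermonde_sq, h4, Finset.prod_congr rfl fun i _ => h3 i, Finset.prod_mul_distrib,
    Finset.prod_mul_distrib, Finset.prod_pow, h1, h2, Finset.prod_const, Finset.card_fin]
  generalize (22 * t) ^ 22 = c
  ring

theorem map_eq_C_mul_prod_rootSet {F K : Type*} [Field F] [Field K] [Algebra F K] {f : F[X]}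
    (hs : (f.map (algebraMap F K)).Splits) (hf : f.Separable) :
    f.map (algebraMap F K) =
      C (algebraMap F K f.leadingCoeff) * ∏ x : f.rootSet K, (X - C (x : K)) := by
  classical
  have hn : (f.aroots K).Nodup := nodup_roots hf.map
  have h1 := hs.eq_prod_roots
  rw [leadingCoeff_map] at h1
  refine h1.trans ?_
  congr 1
  rw [← Finset.prod_subtype (f.aroots K).toFinset (p := fun x => x ∈ f.rootSet K)
    (f := fun x => X - C x) (fun x => by simp [rootSet])]
  rw [Finset.prod_multiset_map_count, Finset.prod_congr rfl]
  intro x hx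
  rw [Multiset.count_eq_one_of_mem hn (Multiset.mem_toFinset.1 hx), pow_one]

theorem prod_X_sub_C_mul_rootSet_family {K : Type*} [Field K] [Algebra ℚ K] (m : ℤ) {f : ℚ[X]}
    (hf : f = C (22 * (m : ℚ) ^ 2 + 506) * X ^ 23 - C (23 * (m : ℚ) ^ 2 + 529) * X ^ 22 + C 23)
    (hirr : Irreducible f) (hs : (f.map (algebraMap ℚ K)).Splits) :
    Fintype.card (f.rootSet K) = 23 ∧
    ∏ x : f.rootSet K, (X - C (22 * ((m : K) ^ 2 + 23) * (x : K))) =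
      X ^ 23 - C (23 * ((m : K) ^ 2 + 23)) * X ^ 22 + C (23 * (22 * ((m : K) ^ 2 + 23)) ^ 22) := by
  have : CharZero K := algebraRat.charZero K
  have hsep := hirr.separable
  have hq : (22 * (m : ℚ) ^ 2 + 506) ≠ 0 := by positivity
  have hdeg : f.natDegree = 23 := by
    rw [hf]
    compute_degree!
    positivity
  have hcard : Fintype.card (f.rootSet K) = 23 := by
    rw [card_rootSet_eq_natDegree hsep hs, hdeg]
  refine ⟨hcard, ?_⟩
  have hlc : f.leadingCoeff = 22 * (m : ℚ) ^ 2 + 506 := by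
    rw [leadingCoeff, hdeg, hf]
    simp only [coeff_add, coeff_sub, coeff_C_mul, coeff_X_pow, coeff_C]
    norm_num
  set c : K := 22 * ((m : K) ^ 2 + 23) with hc
  have hc0 : c ≠ 0 := by
    have h1 : c = algebraMap ℚ K (22 * (m : ℚ) ^ 2 + 506) := by
      rw [hc]; push_cast [map_add, map_mul, map_pow, map_ofNat, map_intCast]; ring
    rw [h1]
    exact (_root_.map_ne_zero _).2 hq
  have hmap := map_eq_C_mul_prod_rootSet hs hsep
  apply Polynomial.funext
  intro z
  have h1 := congrArg (eval (z / c)) hmap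
  have h2 : eval (z / c) (f.map (algebraMap ℚ K)) =
      c * (z / c) ^ 23 - 23 * ((m : K) ^ 2 + 23) * (z / c) ^ 22 + 23 := by
    rw [hf, hc]
    simp only [Polynomial.map_add, Polynomial.map_sub, Polynomial.map_mul, Polynomial.map_pow,
      map_X, map_C, eval_add, eval_sub, eval_mul, eval_pow, eval_X, eval_C, _root_.map_add,
      _root_.map_mul, _root_.map_pow, Polynomial.map_intCast, eval_intCast, map_intCast,
      map_ofNat (algebraMap ℚ K)]
    ring
  have h3 : algebraMap ℚ K f.leadingCoeff = c := by
    rw [hlc, hc]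
    simp only [_root_.map_add, _root_.map_mul, _root_.map_pow, map_intCast,
      map_ofNat (algebraMap ℚ K)]
    ring
  have h4 : ∏ x : f.rootSet K, (z - c * (x : K)) =
      c ^ 23 * ∏ x : f.rootSet K, (z / c - (x : K)) := by
    rw [← hcard, ← Finset.card_univ, ← Finset.prod_const, ← Finset.prod_mul_distrib]
    refine Finset.prod_congr rfl fun x _ => ?_
    field_simp
  simp only [h2, eval_mul, eval_C, eval_prod, eval_sub, eval_X, h3] at h1
  simp only [eval_prod, eval_add, eval_sub, eval_mul, eval_pow, eval_X, eval_C]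
  rw [h4, pow_succ, mul_assoc, ← h1]
  field_simp

theorem exists_algEquiv_isCycle_pow {K : Type*} [Field K] [inst : Algebra ℚ K]
    [FiniteDimensional ℚ K] [IsGalois ℚ K] (m : ℤ) {f : ℚ[X]}
    (hf : f = C (22 * (m : ℚ) ^ 2 + 506) * X ^ 23 - C (23 * (m : ℚ) ^ 2 + 529) * X ^ 22 + C 23)
    (hirr : Irreducible f) (hs : (f.map (algebraMap ℚ K)).Splits) [DecidableEq (f.rootSet K)] :
    ∃ σ : K ≃ₐ[ℚ] K, ∀ π : Equiv.Perm (f.rootSet K), (∀ x, (π x : K) = σ x) →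
      ∃ p n, p.Prime ∧ p ≠ 3 ∧ p + 3 ≤ 23 ∧ (π ^ n).IsCycle ∧ (π ^ n).support.card = p := by
  have : CharZero K := algebraRat.charZero K
  obtain rfl : inst = DivisionRing.toRatAlgebra := Subsingleton.elim _ _
  have : NumberField K := { }
  obtain ⟨hcard, hprod⟩ := prod_X_sub_C_mul_rootSet_family m hf hirr hs
  obtain ⟨Q, hQ, σ, hchar, hσ⟩ := exists_frobenius K 7 (by norm_num)
  let := Ideal.Quotient.field Q
  let P : ℤ[X] := X ^ 23 - C (23 * (m ^ 2 + 23)) * X ^ 22 + C (23 * (22 * (m ^ 2 + 23)) ^ 22)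
  have hPK : ∏ x : f.rootSet K, (X - C (22 * ((m : K) ^ 2 + 23) * (x : K))) =
      P.map (Int.castRingHom K) := by
    rw [hprod]
    simp [P, map_ofNat C]
  have hPmonic : P.Monic := by
    simp only [P]
    monicity!
  have hintegral : ∀ x : f.rootSet K, IsIntegral ℤ (22 * ((m : K) ^ 2 + 23) * (x : K)) := by
    intro x
    refine ⟨P, hPmonic, ?_⟩
    rw [eval₂_eq_eval_map]
    change eval _ (P.map (Int.castRingHom K)) = 0
    rw [← hPK, eval_prod]
    exact Finset.prod_eq_zero (Finset.mem_univ x) (by simp)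
  let b : f.rootSet K → NumberField.RingOfIntegers K := fun x => ⟨_, hintegral x⟩
  have hb : ∏ x, (X - C (b x)) = P.map (Int.castRingHom _) := by
    apply map_injective (algebraMap (NumberField.RingOfIntegers K) K)
      NumberField.RingOfIntegers.coe_injective
    rw [Polynomial.map_map, Polynomial.map_prod]
    simp only [Polynomial.map_sub, map_X, map_C]
    rw [RingHom.ext_int (RingHom.comp _ _) (Int.castRingHom K), ← hPK]
    rfl
  have hρ : ∏ x, (X - C (Ideal.Quotient.mk Q (b x))) = P.map (Int.castRingHom _) := by
    have := congrArg (Polynomial.map (Ideal.Quotient.mk Q)) hb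
    rw [Polynomial.map_map, Polynomial.map_prod] at this
    simp only [Polynomial.map_sub, map_X, map_C] at this
    rw [this]
    congr 1
  refine ⟨σ, fun π hπ => ?_⟩
  refine exists_isCycle_pow_of_card_eq m π (fun x => Ideal.Quotient.mk Q (b x)) (fun x => ?_)
    hcard ?_
  · rw [← hσ]
    congr 1
    apply NumberField.RingOfIntegers.coe_injective
    change 22 * ((m : K) ^ 2 + 23) * (π x : K) = σ (22 * ((m : K) ^ 2 + 23) * (x : K))
    simp [hπ, map_ofNat σ]
  · rw [hρ]
    simp [P, map_ofNat C]

theorem sign_eq_one_of_algEquiv {K : Type*} [Field K] [Algebra ℚ K] (m : ℤ) {f : ℚ[X]}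
    (hf : f = C (22 * (m : ℚ) ^ 2 + 506) * X ^ 23 - C (23 * (m : ℚ) ^ 2 + 529) * X ^ 22 + C 23)
    (hirr : Irreducible f) (hs : (f.map (algebraMap ℚ K)).Splits) [DecidableEq (f.rootSet K)]
    (σ : K ≃ₐ[ℚ] K) (π : Equiv.Perm (f.rootSet K)) (hπ : ∀ x, (π x : K) = σ x) :
    Equiv.Perm.sign π = 1 := by
  have : CharZero K := algebraRat.charZero K
  obtain ⟨hcard, hprod⟩ := prod_X_sub_C_mul_rootSet_family m hf hirr hs
  let e : f.rootSet K ≃ Fin 23 := Fintype.equivFinOfCardEq hcard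
  rw [← Equiv.Perm.sign_permCongr e]
  have hc0 : 22 * ((m : K) ^ 2 + 23) ≠ 0 := by
    have h1 : (22 * (m ^ 2 + 23) : ℤ) ≠ 0 := by positivity
    have h2 := (Int.cast_ne_zero (α := K)).2 h1
    push_cast at h2
    exact h2
  let v : Fin 23 → K := fun i => 22 * ((m : K) ^ 2 + 23) * (e.symm i : K)
  have hv : v.Injective := by
    intro i j h
    exact e.symm.injective (Subtype.ext (mul_left_cancel₀ hc0 h))
  refine sign_eq_one_of_det_vandermonde hv (σ : K →+* K) _ (fun i => ?_) ?_
  · simp [v, hπ, map_ofNat σ]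
  · have h1 := det_vandermonde_sq_of_prod_eq (m : K) v
      ((e.symm.prod_comp fun x : f.rootSet K =>
        X - C (22 * ((m : K) ^ 2 + 23) * (x : K))).trans hprod)
    rcases sq_eq_sq_iff_eq_or_eq_neg.1 h1 with h2 | h2 <;> rw [h2] <;> simp [map_ofNat σ]

theorem isGalois_splittingField {F : Type*} [Field F] {f : F[X]} (hf : f.Separable) :
    IsGalois F f.SplittingField :=
  IsGalois.of_separable_splitting_field hf

theorem isPretransitive_range_toPermHom_gal {F : Type*} [Field F] {f : F[X]}
    (hf : Irreducible f) :
    MulAction.IsPretransitive (MulAction.toPermHom f.Gal (f.rootSet f.SplittingField)).range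
      (f.rootSet f.SplittingField) := by
  refine ⟨fun x y => ?_⟩
  have hx := minpoly.eq_of_irreducible hf (mem_rootSet.mp x.2).2
  have hy := minpoly.eq_of_irreducible hf (mem_rootSet.mp y.2).2
  obtain ⟨g, hg⟩ := (Normal.minpoly_eq_iff_mem_orbit f.SplittingField).mp (hy.symm.trans hx)
  exact ⟨⟨MulAction.toPermHom f.Gal _ g, g, rfl⟩, Subtype.ext hg⟩

/-- For an integer `m` not divisible by 23, the Galois group over ℚ of
`(22m² + 506)x²³ − (23m² + 529)x²² + 23` is the alternating group `A₂₃`. -/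
theorem galois_group_degree_23_family_eq_alternating
    (m : ℤ) (hm : ¬ (23 : ℤ) ∣ m) (f : ℚ[X])
    (hf : f = C (22 * (m : ℚ) ^ 2 + 506) * X ^ 23 -
        C (23 * (m : ℚ) ^ 2 + 529) * X ^ 22 + C 23) :
    Nonempty (f.Gal ≃* alternatingGroup (Fin 23)) := by
  classical
  have hirr : Irreducible f := hf ▸ irreducible_family m hm
  obtain ⟨hcard, -⟩ := @prod_X_sub_C_mul_rootSet_family f.SplittingField _ _ m f hf hirr
    (SplittingField.splits f)
  have hgal := isGalois_splittingField hirr.separable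
  obtain ⟨σ, hσ⟩ := @exists_algEquiv_isCycle_pow f.SplittingField _ _ _ hgal m f hf hirr
    (SplittingField.splits f) _
  let Φ := MulAction.toPermHom f.Gal (f.rootSet f.SplittingField)
  obtain ⟨p, n, hp, hp3, hp23, hcyc, hsupp⟩ := hσ (Φ σ) fun _ => rfl
  have hinj : Function.Injective Φ := by
    rw [injective_iff_map_eq_one]
    intro ϕ hϕ
    ext x hx
    exact congrArg Subtype.val (Equiv.Perm.ext_iff.1 hϕ ⟨x, hx⟩)
  have htrans : MulAction.IsPretransitive Φ.range (f.rootSet f.SplittingField) :=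
    isPretransitive_range_toPermHom_gal hirr
  have hcard' : Nat.card (f.rootSet f.SplittingField) = 23 :=
    (@Nat.card_eq_fintype_card _ _).trans hcard
  have hprim : MulAction.IsPreprimitive Φ.range (f.rootSet f.SplittingField) := by
    apply MulAction.IsPreprimitive.of_prime_card
    rw [hcard']
    norm_num
  have hrange : Φ.range = alternatingGroup (f.rootSet f.SplittingField) := by
    apply le_antisymm
    · rintro _ ⟨τ, rfl⟩
      rw [Equiv.Perm.mem_alternatingGroup]
      exact @sign_eq_one_of_algEquiv f.SplittingField _ _ m f hf hirr (SplittingField.splits f) _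
        τ (Φ τ) fun _ => rfl
    · exact alternatingGroup_le_of_isPreprimitive_of_isCycle_mem hprim hp hp3
        (by rwa [hcard']) hcyc hsupp
        (Subgroup.pow_mem _ (MonoidHom.mem_range.2 ⟨σ, rfl⟩) n)
  exact ⟨(MonoidHom.ofInjective hinj).trans <| (MulEquiv.subgroupCongr hrange).trans
    (Fintype.equivFinOfCardEq hcard).altCongrHom⟩
end
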